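/- arXiv:1210.7836 — 3 statements merged into one kernel-verified Lean document; each statement's English description precedes it below -/
import Mathlib

section
/- Let φ be an anisotropic quasilinear p-form of dimension > 1 over a field F of characteristic p, and write dim φ = p^n + m with n ≥ 0 and 1 ≤ m ≤ p^{n+1} − p^n. Then i₁(φ) ≤ m, where i₁(φ) = i₀(φ_{F(φ)}) is the defect index of φ over the function field of the hypersurface {φ = 0}. -/
open scoped BigOperators

universe u

variable (p : ℕ)

/-- Defect index of the diagonal quasilinear `p`-form with coefficients `b` over a
commutative ring. -/
noncomputable def defectIdx (K : Type u) [CommRing K] {ι : Type} [Fintype ι]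
    (b : ι → K) : ℕ :=
  Module.finrank K (Submodule.span K {x : ι → K | ∑ i, b i * x i ^ p = 0})

/-- Dehomogenization (on the affine chart `x_d = 1`) of the defining equation of the
projective hypersurface `{Σ bᵢ xᵢ^p = 0}`. -/
noncomputable def ffPoly (K : Type u) [Field K] (d : ℕ) (b : Fin (d + 1) → K) :
    MvPolynomial (Fin d) K :=
  MvPolynomial.C (b (Fin.last d)) +
    ∑ i : Fin d, MvPolynomial.C (b i.castSucc) * MvPolynomial.X i ^ p

/-- The function field `K(φ)` of the projective quasilinear `p`-hypersurface
`X_φ = {Σ bᵢ xᵢ^p = 0}`, realized as the fraction field of the coordinate ring of the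
affine chart `x_d = 1` (a variety when `φ` is not completely split). -/
noncomputable abbrev ffRing (K : Type u) [Field K] (d : ℕ) (b : Fin (d + 1) → K) :
    Type u :=
  FractionRing (MvPolynomial (Fin d) K ⧸ Ideal.span {ffPoly p K d b})

/-- The canonical embedding of `K` into the function field `K(φ)`. -/
noncomputable def ffMap (K : Type u) [Field K] (d : ℕ) (b : Fin (d + 1) → K) :
    K →+* ffRing p K d b :=
  (algebraMap _ _).comp ((Ideal.Quotient.mk (Ideal.span {ffPoly p K d b})).comp
    (MvPolynomial.C : K →+* MvPolynomial (Fin d) K))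

/-- The first higher defect index `i₁(φ) = i₀(φ_{K(φ)})`. -/
noncomputable def i1 (K : Type u) [Field K] (d : ℕ) (b : Fin (d + 1) → K) : ℕ :=
  defectIdx p (ffRing p K d b) (fun i => ffMap p K d b (b i))

namespace QL
open Polynomial Module
section core
variable {M : Type*} [Field M]

lemma exists_dmap (δ : M →+ M) (hδ : ∀ a b, δ (a * b) = a * δ b + b * δ a) (t : M) (f : M[X]) :
    ∃ g : M[X], (∀ n, g.coeff n = δ (f.coeff n)) ∧
      δ (f.eval t) = g.eval t + (derivative f).eval t * δ t := by
  have hpow : ∀ n : ℕ, δ (t ^ n) = n * t ^ (n - 1) * δ t := by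
    have h1 : δ 1 = 0 := by
      have := hδ 1 1
      simpa using this
    intro n
    induction n with
    | zero => simp [h1]
    | succ n ih =>
      rw [pow_succ, hδ, ih]
      rcases n with _ | n
      · simp
      · simp; ring
  induction f using Polynomial.induction_on' with
  | add f g hf hg =>
    obtain ⟨a, ha, ha'⟩ := hf
    obtain ⟨b, hb, hb'⟩ := hg
    refine ⟨a + b, fun n => by simp [ha, hb], ?_⟩
    simp only [eval_add, map_add, ha', hb']; ring
  | monomial n a =>
    refine ⟨monomial n (δ a), fun m => ?_, ?_⟩
    · simp only [coeff_monomial]; split_ifs <;> simp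
    · simp only [eval_monomial, hδ, hpow, derivative_monomial]; ring

lemma exists_dmap2 (p : ℕ) [Fact p.Prime] (δ : M →+ M) (hδ : ∀ a b, δ (a * b) = a * δ b + b * δ a)
    (t : M) (f : M[X]) :
    ∃ g : M[X], (∀ n, g.coeff n = δ (f.coeff n)) ∧
      δ (f.eval t) = g.eval t + (derivative f).eval t * δ t ∧
      δ ((derivative f).eval t) = (derivative g).eval t +
        (derivative (derivative f)).eval t * δ t := by
  obtain ⟨g, hg, hg'⟩ := exists_dmap δ hδ t f
  obtain ⟨h, hh, hh'⟩ := exists_dmap δ hδ t (derivative f)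
  refine ⟨g, hg, hg', ?_⟩
  have : h = derivative g := by
    ext n
    rw [hh, coeff_derivative, coeff_derivative, hg]
    have : f.coeff (n+1) * ((n:M)+1) = (n+1) • f.coeff (n+1) := by simp; ring
    rw [this, map_nsmul]; simp; ring
  rw [← this, hh']

variable {K : Type*} [Field K] [Algebra K M]

set_option maxHeartbeats 1000000 in
theorem core (p : ℕ) [hpf : Fact p.Prime] [CharP M p]
    (hp : ∀ m : M, ∃ a : K, algebraMap K M a = m ^ p)
    (V : Submodule K M) [FiniteDimensional K V] (h1 : (1 : M) ∈ V) (t : M)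
    (hV : V ≤ Submodule.span K {z | z = 1 ∨ z = t ∨ ∃ δ : M →+ M,
      (∀ a b, δ (a * b) = a * δ b + b * δ a) ∧ (∀ v ∈ V, δ v ∈ V) ∧ δ t = z})
    (k : ℕ) (hk : p ^ k < finrank K V) :
    p ^ (k + 1) ≤ finrank K ((Subalgebra.toSubmodule (Algebra.adjoin K {t}) * V : Submodule K M)) := by
  have hIntg : ∀ m : M, IsIntegral K m := by
    intro m
    obtain ⟨a, ha⟩ := hp m
    exact IsIntegral.of_pow hpf.out.pos (ha ▸ isIntegral_algebraMap)
  have halg : Algebra.IsAlgebraic K M := ⟨fun m => (hIntg m).isAlgebraic⟩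
  set T : Submodule K M := Subalgebra.toSubmodule (Algebra.adjoin K {t}) with hT
  have hTt : t ∈ T := Algebra.subset_adjoin rfl
  have hTpow : ∀ n : ℕ, t ^ n ∈ T := fun n =>
    pow_mem (Algebra.subset_adjoin rfl : t ∈ Algebra.adjoin K {t}) n
  have hT1 : (1 : M) ∈ T := one_mem (Algebra.adjoin K {t})
  have hTT : T * T = T := Subalgebra.isIdempotentElem_toSubmodule _
  have hTfin : FiniteDimensional K T := by
    have := (hIntg t).fg_adjoin_singleton
    exact Module.Finite.iff_fg.mpr this
  set S : Submodule K M := T * V with hS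
  have hSfin : FiniteDimensional K S := Module.Finite.iff_fg.mpr
    (Submodule.FG.mul (Module.Finite.iff_fg.mp hTfin) (Module.Finite.iff_fg.mp inferInstance))
  have hTS : ∀ a ∈ T, ∀ s ∈ S, a * s ∈ S := by
    intro a ha s hs
    have : T * S = S := by rw [hS, ← mul_assoc, hTT]
    rw [← this]; exact Submodule.mul_mem_mul ha hs
  have hVS : ∀ v ∈ V, v ∈ S := fun v hv => by
    have := Submodule.mul_mem_mul hT1 hv
    rwa [one_mul] at this
  have htS : ∀ s ∈ S, t * s ∈ S := hTS t hTt
  have hpS : ∀ f : M[X], (∀ n, f.coeff n ∈ V) → f.eval t ∈ S := by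
    intro f hf
    rw [eval_eq_sum]
    refine Submodule.sum_mem _ fun n _ => ?_
    change f.coeff n * t ^ n ∈ S
    rw [mul_comm]
    exact Submodule.mul_mem_mul (hTpow n) (hf n)
  have hder : ∀ f : M[X], (∀ n, f.coeff n ∈ V) → ∀ n, (derivative f).coeff n ∈ V := by
    intro f hf n
    rw [coeff_derivative]
    have : f.coeff (n+1) * ((n:M)+1) = (n+1) • f.coeff (n+1) := by simp; ring
    rw [this]; exact nsmul_mem (hf _) _
  -- the stabilizer
  let H0 : Subalgebra K M :=
    { carrier := {h | ∀ s ∈ S, h * s ∈ S}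
      mul_mem' := fun {a b} ha hb s hs => by rw [mul_assoc]; exact ha _ (hb _ hs)
      add_mem' := fun {a b} ha hb s hs => by rw [add_mul]; exact add_mem (ha _ hs) (hb _ hs)
      algebraMap_mem' := fun r s hs => by
        rw [← Algebra.smul_def]; exact S.smul_mem _ hs }
  let H : IntermediateField K M :=
    Subalgebra.IsAlgebraic.toIntermediateField (S := H0) fun x _ => (hIntg x).isAlgebraic
  have hHmem : ∀ h : M, h ∈ H ↔ ∀ s ∈ S, h * s ∈ S := fun h => Iff.rfl
  have htH : t ∈ H := htS
  have h1S : (1:M) ∈ S := hVS _ h1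
  have hHS : ∀ h ∈ H, h ∈ S := fun h hh => by
    have := (hHmem h).1 hh 1 h1S
    rwa [mul_one] at this
  have hHfin : FiniteDimensional K H :=
    Submodule.finiteDimensional_of_le (S₁ := Subalgebra.toSubmodule H.toSubalgebra) (S₂ := S) hHS
  have hcharK : CharP K p := (Algebra.charP_iff K M p).2 inferInstance
  have : ExpChar K p := ExpChar.prime hpf.out
  have hpi : IsPurelyInseparable K H := by
    rw [isPurelyInseparable_iff_pow_mem K p]
    intro x
    obtain ⟨a, ha⟩ := hp x
    refine ⟨1, a, Subtype.ext ?_⟩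
    simpa using ha
  obtain ⟨b, hb⟩ := IsPurelyInseparable.finrank_eq_pow K H p
  -- S1 inside H
  have hS1 : ∀ f : M[X], (∀ n, f.coeff n ∈ V) → f.eval t = 0 → (derivative f).eval t ∈ H := by
    intro f hf hft
    have hg := hpS _ (hder f hf)
    set g := (derivative f).eval t with hgdef
    have key : ∀ v ∈ V, g * v ∈ S := by
      have : V ≤ Submodule.comap (LinearMap.mulLeft K g) S := by
        refine hV.trans (Submodule.span_le.2 ?_)
        rintro z (rfl | rfl | ⟨δ, hδ, hδV, rfl⟩)
        · simpa using hg
        · simpa [mul_comm g] using htS _ hg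
        · obtain ⟨q, hq, hq', -⟩ := exists_dmap2 p δ hδ t f
          have h2 := hpS q (fun n => by rw [hq]; exact hδV _ (hf n))
          rw [hft, map_zero] at hq'
          have : g * δ t = - q.eval t := by linear_combination -hq'
          simpa [this] using h2
      exact this
    rw [hHmem]
    intro s hs
    refine Submodule.mul_induction_on hs (fun m hm n hn => ?_) (fun x y hx hy => ?_)
    · rw [mul_left_comm]; exact hTS _ hm _ (key n hn)
    · rw [mul_add]; exact add_mem hx hy
  have hS2 : ∀ f : M[X], (∀ n, f.coeff n ∈ V) → f.eval t = 0 → (derivative f).eval t = 0 →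
      ∀ v ∈ V, (derivative (derivative f)).eval t * v ∈ H := by
    intro f hf hft hft'
    have hg := hS1 _ (hder f hf) hft'
    set g := (derivative (derivative f)).eval t with hgdef
    have : V ≤ Submodule.comap (LinearMap.mulLeft K g) (Subalgebra.toSubmodule H.toSubalgebra) := by
      refine hV.trans (Submodule.span_le.2 ?_)
      rintro z (rfl | rfl | ⟨δ, hδ, hδV, rfl⟩)
      · simpa using hg
      · exact mul_mem hg htH
      · obtain ⟨q, hq, hq', hq''⟩ := exists_dmap2 p δ hδ t f
        rw [hft, hft', map_zero] at hq'
        rw [hft', map_zero] at hq''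
        have h2 := hS1 q (fun n => by rw [hq]; exact hδV _ (hf n)) (by linear_combination -hq')
        have h3 : g * δ t = - (derivative q).eval t := by linear_combination -hq''
        have h4 := neg_mem h2
        rw [← h3] at h4
        exact h4
    exact this
  by_cases hN : ∃ f : M[X], f.natDegree < p ∧ f ≠ 0 ∧ (∀ n, f.coeff n ∈ V) ∧ f.eval t = 0 ∧
      (derivative f).eval t = 0
  · -- then there is one with nonzero second derivative
    have hN' : ∃ f : M[X], (∀ n, f.coeff n ∈ V) ∧ f.eval t = 0 ∧
      (derivative f).eval t = 0 ∧ (derivative (derivative f)).eval t ≠ 0 := by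
      by_contra hcon
      push Not at hcon
      have : ∀ n : ℕ, ∀ f : M[X], f.natDegree = n → n < p → (∀ n, f.coeff n ∈ V) → f.eval t = 0 →
        (derivative f).eval t = 0 → f = 0 := by
        intro n
        induction n using Nat.strong_induction_on with
        | _ n ih =>
          intro f hfn hnp hf h0 h1
          have h2 := hcon f hf h0 h1
          rcases Nat.eq_zero_or_pos n with hn | hn
          · rw [hn] at hfn
            rw [eq_C_of_natDegree_eq_zero hfn] at h0 ⊢
            simpa using h0
          · exfalso
            have hlt : (derivative f).natDegree < n := by
              rw [← hfn]; exact natDegree_derivative_lt (by omega)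
            have hz := ih _ hlt (derivative f) rfl (hlt.trans hnp) (hder f hf) h1 h2
            have hc := congrArg (fun q => q.coeff (n-1)) hz
            simp only [coeff_derivative, coeff_zero] at hc
            rw [Nat.sub_add_cancel hn] at hc
            have hc' : f.coeff n ≠ 0 := by
              rw [← hfn]
              exact leadingCoeff_ne_zero.2 (fun h => by rw [h] at hfn; simp at hfn; omega)
            have : ((n : ℕ) : M) = 0 := by
              rcases mul_eq_zero.1 hc with h | h
              · exact absurd h hc'
              · rw [← h]
                have : n = (n-1)+1 := by omega
                conv_lhs => rw [this]
                push_cast; rfl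
            rw [CharP.cast_eq_zero_iff M p] at this
            exact absurd (Nat.le_of_dvd hn this) (by omega)
      obtain ⟨f, hfp, hf0, hf, h0, h1⟩ := hN
      exact hf0 (this _ f rfl hfp hf h0 h1)
    obtain ⟨f, hf, h0, h1', h2⟩ := hN'
    have hgV := hS2 f hf h0 h1'
    set g := (derivative (derivative f)).eval t
    have hgH : g ∈ H := by simpa using hgV 1 h1
    have hVH : ∀ v ∈ V, v ∈ H := fun v hv => by
      have := mul_mem (inv_mem hgH) (hgV v hv)
      rwa [inv_mul_cancel_left₀ h2] at this
    have hHS' : finrank K H ≤ finrank K S :=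
      Submodule.finrank_mono (s := Subalgebra.toSubmodule H.toSubalgebra) (t := S) hHS
    have hVH' : finrank K V ≤ finrank K H :=
      Submodule.finrank_mono (s := V) (t := Subalgebra.toSubmodule H.toSubalgebra) hVH
    rw [hb] at hHS' hVH'
    have : k < b := (Nat.pow_lt_pow_iff_right hpf.out.one_lt).1 (hk.trans_le hVH')
    exact (Nat.pow_le_pow_right hpf.out.pos this).trans hHS'
  · push Not at hN
    let P : (Fin p → V) →ₗ[K] M[X] :=
      ∑ j : Fin p, ((Polynomial.monomial (R := M) (j : ℕ)).restrictScalars K) ∘ₗ V.subtype ∘ₗ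
        LinearMap.proj j
    have hPap : ∀ a, P a = ∑ j : Fin p, monomial (j:ℕ) (a j : M) := fun a => by
      simp [P, LinearMap.sum_apply]
    have hPc : ∀ a (j : Fin p), (P a).coeff j = a j := fun a j => by
      rw [hPap, finsetSum_coeff]
      simp [coeff_monomial, Fin.val_inj]
    have hPdeg : ∀ a, (P a).natDegree < p := fun a => by
      rw [hPap, ← Nat.le_sub_one_iff_lt hpf.out.pos]
      refine natDegree_sum_le_of_forall_le _ _ fun j _ => (natDegree_monomial_le _).trans ?_
      have := j.2
      omega
    have hPV : ∀ a n, (P a).coeff n ∈ V := fun a n => by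
      rw [hPap, finsetSum_coeff]
      refine Submodule.sum_mem _ fun j _ => ?_
      rw [coeff_monomial]
      split_ifs
      · exact (a j).2
      · exact zero_mem _
    let ev : M[X] →ₗ[K] M := (Polynomial.leval t).restrictScalars K
    have hev : ∀ f, ev f = f.eval t := fun f => rfl
    let dv : M[X] →ₗ[K] M[X] := (Polynomial.derivative (R := M)).restrictScalars K
    have hdv : ∀ f, dv f = derivative f := fun f => rfl
    let A := ev ∘ₗ P
    have hr := LinearMap.finrank_range_add_finrank_ker A
    have hfr : finrank K (Fin p → V) = p * finrank K V := by
      simp [Module.finrank_pi_fintype]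
    have hrange : finrank K (LinearMap.range A) ≤ finrank K S := by
      refine Submodule.finrank_mono ?_
      rintro _ ⟨a, rfl⟩
      exact hpS _ (hPV a)
    let B : LinearMap.ker A →ₗ[K] (Subalgebra.toSubmodule H.toSubalgebra) :=
      LinearMap.codRestrict _ ((ev ∘ₗ dv ∘ₗ P) ∘ₗ (LinearMap.ker A).subtype) (fun a =>
        hS1 _ (hPV a.1) a.2)
    have hB : Function.Injective B := by
      rw [injective_iff_map_eq_zero]
      intro a ha
      have h2 : (derivative (P a.1)).eval t = 0 := congrArg Subtype.val ha
      have h3 : P a.1 = 0 := by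
        by_contra h
        exact hN _ (hPdeg _) h (hPV _) a.2 h2
      apply Subtype.ext
      funext j
      apply Subtype.ext
      rw [← hPc, h3]; simp
    have hker : finrank K (LinearMap.ker A) ≤ finrank K H :=
      LinearMap.finrank_le_finrank_of_injective (f := B) hB
    -- divisibility
    have hdvd : finrank K H ∣ finrank K S := by
      let SH : Submodule H M :=
        { carrier := S
          add_mem' := fun ha hb => S.add_mem ha hb
          zero_mem' := S.zero_mem
          smul_mem' := fun c x hx => (hHmem c.1).1 c.2 x hx }
      have e : finrank K SH = finrank K S := rfl
      rw [← e, ← Module.finrank_mul_finrank K H SH]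
      exact Dvd.intro _ rfl
    have hSpos : 0 < finrank K S := by
      have : Nontrivial S := ⟨⟨⟨1, h1S⟩, 0, fun h => one_ne_zero (congrArg Subtype.val h)⟩⟩
      exact Module.finrank_pos
    by_contra hlt
    push Not at hlt
    rw [hb] at hker hdvd
    have hbk : b < k + 1 := by
      have := (Nat.le_of_dvd hSpos hdvd).trans_lt hlt
      exact (Nat.pow_lt_pow_iff_right hpf.out.one_lt).1 this
    have hd2 : p ^ b ∣ p ^ (k+1) - finrank K S :=
      Nat.dvd_sub (pow_dvd_pow _ hbk.le) hdvd
    have := Nat.le_of_dvd (by omega) hd2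
    have h5 : p * (p ^ k + 1) ≤ p * finrank K V := Nat.mul_le_mul_left _ hk
    have h6 := hpf.out.pos
    rw [pow_succ'] at this hlt
    rw [mul_add] at h5
    omega

end core
lemma exists_lift_deriv {R M : Type*} [CommRing R] [IsDomain R] [Field M] [Algebra R M]
    [IsFractionRing R M] (D : R →+ R) (hD : ∀ a b, D (a * b) = a * D b + b * D a) :
    ∃ δ : M →+ M, (∀ a b, δ (a * b) = a * δ b + b * δ a) ∧
      ∀ r, δ (algebraMap R M r) = algebraMap R M (D r) := by
  have hD1 : D 1 = 0 := by simpa using hD 1 1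
  let g : R →+* TrivSqZeroExt M M :=
    { toFun := fun r => TrivSqZeroExt.inl (algebraMap R M r) +
        TrivSqZeroExt.inr (algebraMap R M (D r))
      map_one' := by ext <;> simp [hD1]
      map_zero' := by ext <;> simp
      map_mul' := fun a b => by 
        ext
        · simp
        · simp [hD]
          simp only [Algebra.smul_def]; ring
      map_add' := fun a b => by ext <;> simp [Algebra.smul_def] }
  have hg : ∀ y : nonZeroDivisors R, IsUnit (g y) := by
    intro y
    rw [TrivSqZeroExt.isUnit_iff_isUnit_fst]
    simp [g]
  let G : M →+* TrivSqZeroExt M M := IsLocalization.lift hg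
  have hG : ∀ r, G (algebraMap R M r) = g r := fun r => IsLocalization.lift_eq hg r
  have hfst : ∀ m, (G m).fst = m := by
    have : ((TrivSqZeroExt.fstHom M M M : TrivSqZeroExt M M →ₐ[M] M) : TrivSqZeroExt M M →+* M).comp G
        = RingHom.id M := by
      apply IsLocalization.ringHom_ext (nonZeroDivisors R)
      ext r
      simp [hG, g]
    intro m
    exact congrArg (fun f => f m) this
  refine ⟨⟨⟨fun m => (G m).snd, by simp⟩, by simp⟩, ?_, ?_⟩
  · intro a b
    simp [hfst, mul_comm b]
  · intro r
    simp [hG, g]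
    simp only [Algebra.smul_def]; simp

lemma finish {E : Type*} {M : Type*} [Field E] [Field M] (p : ℕ) [Fact p.Prime] [CharP M p]
    {n : ℕ} (Φ : E →+* M) (c' : Fin n → E) (e : Fin n → M) (u : M) (hu : u ≠ 0)
    (h : ∀ i, Φ (c' i) = (u * e i) ^ p) {K : Type*} [Field K] [Algebra K M]
    (T : IntermediateField K M) (hT : ∀ x, Φ x ∈ T) :
    Module.finrank E (Submodule.span E {x : Fin n → E | ∑ i, c' i * x i ^ p = 0})
      + finrank T (Submodule.span T (Set.range e)) ≤ n := by
  let _ : Algebra E M := Φ.toAlgebra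
  have hsm : ∀ (a : E) (m : M), a • m = Φ a * m := fun a m => rfl
  let ℓ : (Fin n → E) →ₗ[E] M := Fintype.linearCombination E e
  have hℓ : ∀ y, ℓ y = ∑ i, Φ (y i) * e i := fun y => by
    simp [ℓ, Fintype.linearCombination_apply, hsm]
  have h1 : finrank E (Submodule.span E {x : Fin n → E | ∑ i, c' i * x i ^ p = 0})
      ≤ finrank E (LinearMap.ker ℓ) := by
    refine Submodule.finrank_mono (Submodule.span_le.2 fun x hx => ?_)
    have hx' : ∑ i, c' i * x i ^ p = 0 := hx
    have h2 := congrArg Φ hx'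
    simp only [map_sum, map_mul, map_pow, map_zero, h, ← mul_pow] at h2
    rw [← sum_pow_char] at h2
    have h3 := pow_eq_zero_iff (Fact.out : p.Prime).ne_zero |>.1 h2
    have h4 : u * ℓ x = 0 := by
      rw [hℓ, Finset.mul_sum, ← h3]
      exact Finset.sum_congr rfl fun i _ => by ring
    exact (mul_eq_zero.1 h4).resolve_left hu
  have hr := LinearMap.finrank_range_add_finrank_ker ℓ
  have hrange : LinearMap.range ℓ = Submodule.span E (Set.range e) :=
    Fintype.range_linearCombination E e
  have h2 : finrank T (Submodule.span T (Set.range e)) ≤ finrank E (LinearMap.range ℓ) := by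
    rw [hrange]
    have := FiniteDimensional.span_of_finite E (Set.finite_range e)
    let b := Module.finBasis E (Submodule.span E (Set.range e))
    let b' : Fin (finrank E (Submodule.span E (Set.range e))) → M := fun j => (b j : M)
    have hle : Submodule.span T (Set.range e) ≤ Submodule.span T (Set.range b') := by
      rw [Submodule.span_le]
      rintro _ ⟨i, rfl⟩
      have hmem : e i ∈ Submodule.span E (Set.range e) := Submodule.subset_span ⟨i, rfl⟩
      have hs := congrArg Subtype.val (b.sum_repr ⟨e i, hmem⟩)
      simp only [Submodule.coe_sum, Submodule.coe_smul] at hs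
      rw [← hs]
      refine Submodule.sum_mem _ fun j _ => ?_
      exact Submodule.smul_mem _ (⟨Φ _, hT _⟩ : T) (Submodule.subset_span ⟨j, rfl⟩)
    have := FiniteDimensional.span_of_finite T (Set.finite_range b')
    refine (Submodule.finrank_mono hle).trans ?_
    have := finrank_range_le_card (R := T) b'
    simpa [Set.finrank] using this
  simp at hr
  omega

lemma span_bound {K M : Type*} [Field K] [Field M] [Algebra K M] (p k : ℕ) [Fact p.Prime]
    {n : ℕ} (e : Fin n → M) (t : M) (ht : finrank K (IntermediateField.adjoin K {t}) = p)
    (h : p ^ (k+1) ≤ finrank K ((Subalgebra.toSubmodule (Algebra.adjoin K {t}) *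
      Submodule.span K (Set.range e) : Submodule K M))) :
    p ^ k ≤ finrank (IntermediateField.adjoin K {t})
      (Submodule.span (IntermediateField.adjoin K {t}) (Set.range e)) := by
  set T := IntermediateField.adjoin K {t} with hT
  have hp := (Fact.out : p.Prime).pos
  have : FiniteDimensional K T := FiniteDimensional.of_finrank_pos (by omega)
  have := FiniteDimensional.span_of_finite T (Set.finite_range e)
  set W := Submodule.span T (Set.range e)
  have : FiniteDimensional K W := Module.Finite.trans T W
  have hle : (Subalgebra.toSubmodule (Algebra.adjoin K {t}) *
      Submodule.span K (Set.range e) : Submodule K M) ≤ W.restrictScalars K := by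
    rw [Submodule.mul_le]
    intro a ha v hv
    have hv' : v ∈ W.restrictScalars K := by
      have : Submodule.span K (Set.range e) ≤ W.restrictScalars K :=
        Submodule.span_le.2 Submodule.subset_span
      exact this hv
    exact W.smul_mem (⟨a, IntermediateField.algebra_adjoin_le_adjoin K {t} ha⟩ : T) hv'
  have : FiniteDimensional K (W.restrictScalars K) := this
  have h1 := h.trans (Submodule.finrank_mono hle)
  have : Module.Free T W := Module.Free.of_divisionRing T W
  have h2 : finrank K (W.restrictScalars K) = p * finrank T W := by
    rw [← ht, Module.finrank_mul_finrank K T W]; rfl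
  rw [h2, pow_succ'] at h1
  exact Nat.le_of_mul_le_mul_left h1 hp
section setup
variable (p : ℕ) [hpf : Fact p.Prime] {F : Type*} [Field F] [CharP F p] (r : ℕ)


/-- The coefficientwise Frobenius map, into the fraction field. -/
noncomputable def rho (F : Type*) [Field F] [CharP F p] :
    MvPolynomial (Fin r) F →+* FractionRing (MvPolynomial (Fin r) F) :=
  (algebraMap _ _).comp (MvPolynomial.map (frobenius F p))

lemma rho_apply (P : MvPolynomial (Fin r) F) :
    rho p r F P = algebraMap _ _ (MvPolynomial.map (frobenius F p) P) := rfl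

lemma rho_inj : Function.Injective (rho p r F) :=
  (IsFractionRing.injective _ _).comp (MvPolynomial.map_injective _ (frobenius_inj F p))

/-- The coefficientwise Frobenius map on the fraction field. -/
noncomputable def sigma (F : Type*) [Field F] [CharP F p] :
    FractionRing (MvPolynomial (Fin r) F) →+* FractionRing (MvPolynomial (Fin r) F) :=
  IsFractionRing.lift (rho_inj p r (F := F))

lemma sigma_alg (P : MvPolynomial (Fin r) F) :
    sigma p r F (algebraMap _ _ P) = rho p r F P :=
  IsFractionRing.lift_algebraMap _ _

/-- The subfield `F^p(Y)`. -/
noncomputable def KK (F : Type*) [Field F] [CharP F p] :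
    Subfield (FractionRing (MvPolynomial (Fin r) F)) :=
  (sigma p r F).fieldRange

lemma rho_mem (P : MvPolynomial (Fin r) F) : rho p r F P ∈ KK p r F :=
  ⟨algebraMap _ _ P, sigma_alg p r P⟩

lemma Y_mem (i : Fin r) : algebraMap (MvPolynomial (Fin r) F) (FractionRing (MvPolynomial (Fin r) F)) (MvPolynomial.X i) ∈ KK p r F := by
  have := rho_mem p r (F := F) (MvPolynomial.X i)
  simpa [rho_apply] using this

lemma pow_mem_KK (m : FractionRing (MvPolynomial (Fin r) F)) : m ^ p ∈ KK p r F := by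
  obtain ⟨P, Q, hQ, rfl⟩ := IsFractionRing.div_surjective (A := MvPolynomial (Fin r) F) m
  have h : ∀ P : MvPolynomial (Fin r) F,
      (algebraMap _ (FractionRing (MvPolynomial (Fin r) F)) P) ^ p ∈ KK p r F := by
    intro P
    have := rho_mem p r (F := F) (MvPolynomial.expand p P)
    rw [rho_apply, MvPolynomial.map_frobenius_expand, map_pow] at this
    exact this
  rw [div_pow]
  exact div_mem (h P) (h Q)

lemma linInd {n : ℕ} (c : Fin n → F)
    (haniso : ∀ x : Fin n → F, ∑ i, c i * x i ^ p = 0 → x = 0) :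
    LinearIndependent (KK p r F) (fun i => algebraMap (MvPolynomial (Fin r) F)
      (FractionRing (MvPolynomial (Fin r) F)) (MvPolynomial.C (c i))) := by
  rw [Fintype.linearIndependent_iff]
  intro κ hκ
  have hex : ∀ i, ∃ m, sigma p r F m = (κ i : FractionRing (MvPolynomial (Fin r) F)) :=
    fun i => (κ i).2
  choose m hm using hex
  obtain ⟨Q, hQ⟩ := IsLocalization.exist_integer_multiples_of_finite
    (nonZeroDivisors (MvPolynomial (Fin r) F)) m
  choose P hP using hQ
  have hP' : ∀ i, rho p r F (P i) = rho p r F Q * κ i := by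
    intro i
    rw [← sigma_alg, hP, Algebra.smul_def, map_mul, hm, sigma_alg]
  have h1 : ∑ i, rho p r F (P i) * algebraMap (MvPolynomial (Fin r) F) (FractionRing (MvPolynomial (Fin r) F)) (MvPolynomial.C (c i)) = 0 := by
    have h2 : ∑ i, rho p r F (P i) * algebraMap (MvPolynomial (Fin r) F) (FractionRing (MvPolynomial (Fin r) F)) (MvPolynomial.C (c i)) =
        rho p r F Q * ∑ i, κ i • algebraMap (MvPolynomial (Fin r) F) (FractionRing (MvPolynomial (Fin r) F)) (MvPolynomial.C (c i)) := by
      rw [Finset.mul_sum]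
      refine Finset.sum_congr rfl fun i _ => ?_
      rw [hP', mul_assoc]; rfl
    rw [h2, hκ, mul_zero]
  simp only [rho_apply, ← map_mul, ← map_sum] at h1
  have h2 := (map_eq_zero_iff _ (IsFractionRing.injective _ _)).1 h1
  have hP0 : ∀ i, P i = 0 := by
    intro i
    ext s
    have h3 := congrArg (MvPolynomial.coeff s) h2
    rw [MvPolynomial.coeff_sum] at h3
    have h3' : ∀ i, MvPolynomial.coeff s (MvPolynomial.map (frobenius F p) (P i) *
        MvPolynomial.C (c i)) = c i * MvPolynomial.coeff s (P i) ^ p := fun i => by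
      rw [mul_comm, MvPolynomial.coeff_C_mul, MvPolynomial.coeff_map, frobenius_def]
    simp only [h3', MvPolynomial.coeff_zero] at h3
    have h4 := haniso (fun i => MvPolynomial.coeff s (P i)) h3
    simpa using congrFun h4 i
  intro i
  have h5 := hP' i
  rw [hP0, map_zero] at h5
  have h6 : rho p r F Q ≠ 0 := by
    rw [Ne, map_eq_zero_iff _ (rho_inj p r)]
    exact nonZeroDivisors.coe_ne_zero Q
  exact Subtype.ext ((mul_eq_zero.1 h5.symm).resolve_left h6)

lemma deriv_KK (j : Fin r) : ∃ δ : FractionRing (MvPolynomial (Fin r) F) →+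
      FractionRing (MvPolynomial (Fin r) F), (∀ a b, δ (a * b) = a * δ b + b * δ a) ∧
    (∀ P, δ (algebraMap (MvPolynomial (Fin r) F) (FractionRing (MvPolynomial (Fin r) F)) P) = algebraMap _ _ (MvPolynomial.pderiv j P)) ∧
    ∀ a ∈ KK p r F, δ a ∈ KK p r F := by
  obtain ⟨δ, h1, h2⟩ := exists_lift_deriv (M := FractionRing (MvPolynomial (Fin r) F))
    (MvPolynomial.pderiv j : Derivation F (MvPolynomial (Fin r) F) _).toLinearMap.toAddMonoidHom
    (fun a b => by simp)
  refine ⟨δ, h1, h2, ?_⟩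
  have h3 : ∀ P, δ (rho p r F P) = rho p r F (MvPolynomial.pderiv j P) := by
    intro P
    rw [rho_apply, rho_apply, h2]
    simp [MvPolynomial.pderiv_map]
  rintro _ ⟨m, rfl⟩
  obtain ⟨P, Q, hQ, rfl⟩ := IsFractionRing.div_surjective (A := MvPolynomial (Fin r) F) m
  have hQ0 : rho p r F Q ≠ 0 := by
    rw [Ne, map_eq_zero_iff _ (rho_inj p r)]
    exact nonZeroDivisors.ne_zero hQ
  rw [map_div₀, sigma_alg, sigma_alg]
  have h4 := h1 (rho p r F P / rho p r F Q) (rho p r F Q)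
  rw [div_mul_cancel₀ _ hQ0, h3, h3] at h4
  have h5 : δ (rho p r F P / rho p r F Q) = (rho p r F (MvPolynomial.pderiv j P) -
      rho p r F P / rho p r F Q * rho p r F (MvPolynomial.pderiv j Q)) / rho p r F Q := by
    rw [eq_div_iff hQ0, h4]; ring
  rw [h5]
  exact div_mem (sub_mem (rho_mem ..) (mul_mem (div_mem (rho_mem ..) (rho_mem ..)) (rho_mem ..)))
    (rho_mem ..)

end setup
section final

lemma minpoly_t {K M : Type*} [Field K] [Field M] [Algebra K M] (p : ℕ) [hpf : Fact p.Prime]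
    [CharP M p] (t : M) (ht : ∀ b : K, algebraMap K M b ≠ t) (a : K)
    (ha : algebraMap K M a = t ^ p) : minpoly K t = X ^ p - C a := by
  symm
  apply minpoly.eq_of_irreducible_of_monic
  · apply X_pow_sub_C_irreducible_of_prime hpf.out
    intro b hb
    apply ht b
    apply frobenius_inj M p
    simp only [frobenius_def, ← ha, ← hb, map_pow]
  · simp [ha]
  · exact monic_X_pow_sub_C _ hpf.out.ne_zero

variable {p : ℕ} [hpf : Fact p.Prime] {F : Type u} [Field F] [CharP F p] (r : ℕ)

/-- The constants in the rational function field. -/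
noncomputable def ee (c : Fin (r + 2) → F) (i : Fin (r + 2)) :
    FractionRing (MvPolynomial (Fin r) F) :=
  algebraMap (MvPolynomial (Fin r) F) _ (MvPolynomial.C (c i / c 0))

/-- The generic element. -/
noncomputable def tt (c : Fin (r + 2) → F) : FractionRing (MvPolynomial (Fin r) F) :=
  -(ee r c (Fin.last _) + ∑ j : Fin r, ee r c j.succ.castSucc *
    algebraMap (MvPolynomial (Fin r) F) _ (MvPolynomial.X j))

lemma aniso_div (c : Fin (r + 2) → F)
    (haniso : ∀ x : Fin (r + 2) → F, ∑ i, c i * x i ^ p = 0 → x = 0) (h0 : c 0 ≠ 0) :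
    ∀ x : Fin (r + 2) → F, ∑ i, c i / c 0 * x i ^ p = 0 → x = 0 := by
  intro x hx
  apply haniso
  have : ∑ i, c i * x i ^ p = c 0 * ∑ i, c i / c 0 * x i ^ p := by
    rw [Finset.mul_sum]
    refine Finset.sum_congr rfl fun i _ => ?_
    field_simp
  rw [this, hx, mul_zero]

lemma c_ne (c : Fin (r + 2) → F)
    (haniso : ∀ x : Fin (r + 2) → F, ∑ i, c i * x i ^ p = 0 → x = 0) : c 0 ≠ 0 := by
  intro h
  have := haniso (Pi.single 0 1) (by
    rw [Finset.sum_eq_single 0]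
    · simp [h]
    · intro i _ hi; simp [hi, hpf.out.ne_zero]
    · simp)
  have := congrFun this 0
  simp at this

lemma linInd_ee (c : Fin (r + 2) → F)
    (haniso : ∀ x : Fin (r + 2) → F, ∑ i, c i * x i ^ p = 0 → x = 0) :
    LinearIndependent (KK p r F) (ee r c) :=
  linInd p r (fun i => c i / c 0) (aniso_div r c haniso (c_ne r c haniso))

lemma ee_zero (c : Fin (r + 2) → F) (h0 : c 0 ≠ 0) : ee r c 0 = 1 := by
  simp [ee, h0]

lemma tt_notin (c : Fin (r + 2) → F)
    (haniso : ∀ x : Fin (r + 2) → F, ∑ i, c i * x i ^ p = 0 → x = 0) :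
    ∀ b : KK p r F, algebraMap (KK p r F) (FractionRing (MvPolynomial (Fin r) F)) b ≠ tt r c := by
  intro b hb
  have h := linInd_ee r c haniso
  rw [Fintype.linearIndependent_iff] at h
  have h2 := h (Fin.cons b (Fin.snoc (fun j => ⟨_, Y_mem p r j⟩) 1 : Fin (r+1) → KK p r F)) (by
    rw [Fin.sum_univ_succ, Fin.sum_univ_castSucc]
    simp only [Fin.cons_zero, Fin.cons_succ, Fin.snoc_castSucc, Fin.snoc_last, map_one, one_mul,
      ee_zero r c (c_ne r c haniso), Algebra.smul_def, hb, mul_one]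
    rw [tt]
    have : ∀ j : Fin r, j.castSucc.succ = j.succ.castSucc := fun j => Fin.succ_castSucc j
    simp only [this, Fin.succ_last]
    have h3 : ∀ j : Fin r, (algebraMap (KK p r F) (FractionRing (MvPolynomial (Fin r) F)))
        ⟨_, Y_mem p r j⟩ = algebraMap (MvPolynomial (Fin r) F) _ (MvPolynomial.X j) :=
      fun j => rfl
    simp only [h3, mul_comm (ee r c _)]
    ring) (Fin.last _)
  rw [← Fin.succ_last, Fin.cons_succ, Fin.snoc_last] at h2
  exact one_ne_zero h2

set_option synthInstance.maxHeartbeats 400000 in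
set_option maxHeartbeats 1000000 in
lemma rank_bound (c : Fin (r + 2) → F)
    (haniso : ∀ x : Fin (r + 2) → F, ∑ i, c i * x i ^ p = 0 → x = 0) (k : ℕ)
    (hk : p ^ k < r + 2) :
    p ^ k ≤ finrank (IntermediateField.adjoin (KK p r F) {tt r c})
      (Submodule.span (IntermediateField.adjoin (KK p r F) {tt r c}) (Set.range (ee r c))) := by
  have h0 := c_ne r c haniso
  have hli := linInd_ee r c haniso
  have hcM : CharP (FractionRing (MvPolynomial (Fin r) F)) p := inferInstance
  apply span_bound
  · have hmin := minpoly_t p (tt r c) (tt_notin r c haniso) ⟨_, pow_mem_KK p r _⟩ rfl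
    rw [IntermediateField.adjoin.finrank, hmin, natDegree_X_pow_sub_C]
    apply IsIntegral.of_pow hpf.out.pos
    exact isIntegral_algebraMap (R := KK p r F) (x := ⟨_, pow_mem_KK p r (tt r c)⟩)
  have := FiniteDimensional.span_of_finite (KK p r F) (Set.finite_range (ee r c))
  have hmemV : ∀ i, ee r c i ∈ Submodule.span (KK p r F) (Set.range (ee r c)) :=
    fun i => Submodule.subset_span ⟨i, rfl⟩
  apply core p (fun m => ⟨⟨_, pow_mem_KK p r m⟩, rfl⟩)
  · rw [← ee_zero r c h0]; exact hmemV 0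
  · rw [Submodule.span_le]
    rintro _ ⟨i, rfl⟩
    set Z := {z | z = 1 ∨ z = tt r c ∨ ∃ δ : FractionRing (MvPolynomial (Fin r) F) →+
      FractionRing (MvPolynomial (Fin r) F),
      (∀ a b, δ (a * b) = a * δ b + b * δ a) ∧
      (∀ v ∈ Submodule.span (KK p r F) (Set.range (ee r c)),
        δ v ∈ Submodule.span (KK p r F) (Set.range (ee r c))) ∧ δ (tt r c) = z} with hZ
    have hmid : ∀ j : Fin r, ee r c j.succ.castSucc ∈ Submodule.span (KK p r F) Z := by
      intro j
      obtain ⟨δ, h1, h2, h3⟩ := deriv_KK p (F := F) r j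
      have h4 : ∀ i, δ (ee r c i) = 0 := fun i => by rw [ee, h2]; simp
      have h5 : δ (tt r c) = - ee r c j.succ.castSucc := by
        rw [tt, map_neg, map_add, h4, map_sum]
        simp only [h1, h4, h2, MvPolynomial.pderiv_X]
        rw [Finset.sum_eq_single j]
        · simp
        · intro b _ hb
          simp [hb]
        · simp
      rw [← neg_neg (ee r c j.succ.castSucc), ← h5]
      refine neg_mem (Submodule.subset_span (Or.inr (Or.inr ⟨δ, h1, ?_, rfl⟩)))
      intro v hv
      induction hv using Submodule.span_induction with
      | mem x hx => obtain ⟨i, rfl⟩ := hx; rw [h4]; exact zero_mem _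
      | zero => rw [map_zero]; exact zero_mem _
      | add x y _ _ hx hy => rw [map_add]; exact add_mem hx hy
      | smul a x hx hx' =>
        have : δ (a • x) = a • δ x + (⟨δ a, h3 _ a.2⟩ : KK p r F) • x := by
          simp only [Algebra.smul_def]
          have h6 := h1 (algebraMap (KK p r F) _ a) x
          rw [h6, mul_comm x]; rfl
        rw [this]
        exact add_mem (Submodule.smul_mem _ _ hx') (Submodule.smul_mem _ _ hx)
    change ee r c i ∈ Submodule.span (KK p r F) Z
    refine Fin.lastCases ?_ (fun i => ?_) i
    · have : ee r c (Fin.last _) = - tt r c - ∑ j : Fin r,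
          (⟨_, Y_mem p r j⟩ : KK p r F) • ee r c j.succ.castSucc := by
        rw [tt]
        have : ∀ j : Fin r, (⟨_, Y_mem p r j⟩ : KK p r F) • ee r c j.succ.castSucc =
          ee r c j.succ.castSucc * algebraMap (MvPolynomial (Fin r) F) _ (MvPolynomial.X j) :=
          fun j => mul_comm _ _
        simp only [this]; ring
      rw [this]
      refine sub_mem (neg_mem (Submodule.subset_span (Or.inr (Or.inl rfl)))) ?_
      exact Submodule.sum_mem _ fun j _ => Submodule.smul_mem _ _ (hmid j)
    · refine Fin.cases ?_ (fun j => hmid j) i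
      refine Submodule.subset_span (Or.inl ?_)
      exact ee_zero r c h0
  · rw [finrank_span_eq_card hli]; simpa using hk

/-- The map to the rational function field, before passing to the quotient. -/
noncomputable def Phi0 (c : Fin (r + 2) → F) :
    MvPolynomial (Fin (r + 1)) F →+* FractionRing (MvPolynomial (Fin r) F) :=
  (Polynomial.eval₂RingHom (rho p r F) (tt r c)).comp
    (MvPolynomial.finSuccEquiv F r : MvPolynomial (Fin (r + 1)) F →+* _)

lemma Phi0_apply (c : Fin (r + 2) → F) (g) : Phi0 (p := p) r c g =
    (MvPolynomial.finSuccEquiv F r g).eval₂ (rho p r F) (tt r c) := rfl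

lemma Phi0_C (c : Fin (r + 2) → F) (a : F) : Phi0 (p := p) r c (MvPolynomial.C a) =
    (algebraMap (MvPolynomial (Fin r) F) _ (MvPolynomial.C a)) ^ p := by
  rw [Phi0_apply, MvPolynomial.finSuccEquiv_apply]
  simp [rho_apply, frobenius_def]

lemma Phi0_X0 (c : Fin (r + 2) → F) : Phi0 (p := p) r c (MvPolynomial.X 0) = tt r c := by
  rw [Phi0_apply, MvPolynomial.finSuccEquiv_X_zero, eval₂_X]

lemma Phi0_Xs (c : Fin (r + 2) → F) (j : Fin r) : Phi0 (p := p) r c (MvPolynomial.X j.succ) =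
    algebraMap (MvPolynomial (Fin r) F) _ (MvPolynomial.X j) := by
  rw [Phi0_apply, MvPolynomial.finSuccEquiv_X_succ, eval₂_C, rho_apply, MvPolynomial.map_X]

lemma C_mul_ee (c : Fin (r + 2) → F) (h0 : c 0 ≠ 0) (i) :
    algebraMap (MvPolynomial (Fin r) F) (FractionRing (MvPolynomial (Fin r) F))
      (MvPolynomial.C (c i)) = algebraMap (MvPolynomial (Fin r) F) _ (MvPolynomial.C (c 0)) *
      ee r c i := by
  rw [ee, ← map_mul, ← map_mul, mul_div_cancel₀ _ h0]

lemma Phi0_ff (c : Fin (r + 2) → F) (h0 : c 0 ≠ 0) :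
    Phi0 (p := p) r c (ffPoly p F (r + 1) c) = 0 := by
  have hcM : CharP (FractionRing (MvPolynomial (Fin r) F)) p := inferInstance
  rw [ffPoly, map_add, Fin.sum_univ_succ, map_add, map_sum]
  simp only [map_mul, map_pow, Phi0_C, Phi0_X0, Phi0_Xs, ← mul_pow]
  rw [← sum_pow_char, ← add_pow_char, ← add_pow_char]
  apply (pow_eq_zero_iff hpf.out.ne_zero).2
  have hC := C_mul_ee r c h0
  generalize algebraMap (MvPolynomial (Fin r) F) (FractionRing (MvPolynomial (Fin r) F))
    (MvPolynomial.C (c 0)) = z at hC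
  simp only [hC]
  rw [Fin.castSucc_zero, ee_zero r c h0, tt]
  simp only [mul_assoc, ← Finset.mul_sum]
  ring

lemma Phi0_ker (c : Fin (r + 2) → F)
    (haniso : ∀ x : Fin (r + 2) → F, ∑ i, c i * x i ^ p = 0 → x = 0) :
    RingHom.ker (Phi0 (p := p) r c) ≤ Ideal.span {ffPoly p F (r + 1) c} := by
  have hcM : CharP (FractionRing (MvPolynomial (Fin r) F)) p := inferInstance
  have h0 := c_ne r c haniso
  intro g hg
  rw [RingHom.mem_ker, Phi0_apply] at hg
  rw [Ideal.mem_span_singleton]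
  -- transport
  let q : (MvPolynomial (Fin r) F)[X] :=
    X ^ p + C (MvPolynomial.C (c 0)⁻¹ * (MvPolynomial.C (c (Fin.last _)) +
      ∑ j : Fin r, MvPolynomial.C (c j.succ.castSucc) * MvPolynomial.X j ^ p))
  have hqm : q.Monic := monic_X_pow_add_C _ hpf.out.ne_zero
  have hqd : q.degree = p := degree_X_pow_add_C hpf.out.pos _
  have hqf : MvPolynomial.finSuccEquiv F r (ffPoly p F (r + 1) c) =
      C (MvPolynomial.C (c 0)) * q := by
    have hC : ∀ a, MvPolynomial.finSuccEquiv F r (MvPolynomial.C a) = C (MvPolynomial.C a) := by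
      intro a; rw [MvPolynomial.finSuccEquiv_apply]; simp
    rw [ffPoly, map_add, Fin.sum_univ_succ, map_add, map_sum]
    simp only [map_mul, map_pow, hC, MvPolynomial.finSuccEquiv_X_zero,
      MvPolynomial.finSuccEquiv_X_succ, q, Fin.castSucc_zero]
    rw [mul_add, ← mul_assoc (C (MvPolynomial.C (c 0)))]
    rw [← map_mul C, ← map_mul MvPolynomial.C, mul_inv_cancel₀ h0]
    simp
    ring
  have hu : IsUnit (C (MvPolynomial.C (c 0)) : (MvPolynomial (Fin r) F)[X]) :=
    ((isUnit_iff_ne_zero.2 h0).map MvPolynomial.C).map C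
  have hqe : q.eval₂ (rho p r F) (tt r c) = 0 := by
    have h1 := Phi0_ff (p := p) r c h0
    rw [Phi0_apply, hqf, eval₂_mul] at h1
    refine (mul_eq_zero.1 h1).resolve_left ?_
    rw [eval₂_C, map_eq_zero_iff _ (rho_inj p r)]
    simpa using h0
  have hdvd : q ∣ MvPolynomial.finSuccEquiv F r g := by
    rw [← modByMonic_eq_zero_iff_dvd hqm]
    set s := MvPolynomial.finSuccEquiv F r g %ₘ q with hs
    have hse : s.eval₂ (rho p r F) (tt r c) = 0 := by
      have h1 := modByMonic_add_div (MvPolynomial.finSuccEquiv F r g) q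
      rw [← h1, eval₂_add, eval₂_mul, hqe, zero_mul, add_zero] at hg
      exact hg
    have hsd : s.degree < p := by
      rw [← hqd]; exact degree_modByMonic_lt _ hqm
    -- coefficients in K
    let ρ' : MvPolynomial (Fin r) F →+* KK p r F :=
      (rho p r F).codRestrict (KK p r F) (rho_mem p r)
    have hρ' : Function.Injective ρ' := fun a b hab =>
      rho_inj p r (congrArg Subtype.val hab)
    have hmin := minpoly_t p (tt r c) (tt_notin r c haniso) ⟨_, pow_mem_KK p r _⟩ rfl
    have hz : s.map ρ' = 0 := by
      apply Polynomial.eq_zero_of_dvd_of_degree_lt (p := minpoly (KK p r F) (tt r c))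
      · apply minpoly.dvd
        rw [aeval_def, eval₂_map]
        exact hse
      · rw [hmin, degree_X_pow_sub_C hpf.out.pos]
        exact (degree_map_le).trans_lt hsd
    exact (Polynomial.map_eq_zero_iff hρ').1 hz
  have h2 : MvPolynomial.finSuccEquiv F r (ffPoly p F (r + 1) c) ∣
      MvPolynomial.finSuccEquiv F r g := by
    rw [hqf]
    exact hu.mul_left_dvd.2 hdvd
  exact (map_dvd_iff (MvPolynomial.finSuccEquiv F r)).1 h2

lemma Phi0_mem (c : Fin (r + 2) → F) (g : MvPolynomial (Fin (r + 1)) F) :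
    Phi0 (p := p) r c g ∈ IntermediateField.adjoin (KK p r F) {tt r c} := by
  have hK : ∀ x ∈ KK p r F, x ∈ IntermediateField.adjoin (KK p r F) {tt r c} := fun x hx =>
    (IntermediateField.adjoin (KK p r F) {tt r c}).algebraMap_mem ⟨x, hx⟩
  rw [Phi0_apply, eval₂_eq_sum]
  refine sum_mem fun n _ => ?_
  exact mul_mem (hK _ (rho_mem ..)) (pow_mem (IntermediateField.mem_adjoin_simple_self _ _) n)

set_option synthInstance.maxHeartbeats 400000 in
set_option maxHeartbeats 1000000 in
lemma main (c : Fin (r + 2) → F)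
    (haniso : ∀ x : Fin (r + 2) → F, ∑ i, c i * x i ^ p = 0 → x = 0) (k : ℕ)
    (hk : p ^ k < r + 2) : i1 p F (r + 1) c + p ^ k ≤ r + 2 := by
  have hcM : CharP (FractionRing (MvPolynomial (Fin r) F)) p := inferInstance
  have h0 := c_ne r c haniso
  have hvan : ∀ a ∈ Ideal.span {ffPoly p F (r + 1) c}, Phi0 (p := p) r c a = 0 := by
    have : Ideal.span {ffPoly p F (r + 1) c} ≤ RingHom.ker (Phi0 (p := p) r c) := by
      rw [Ideal.span_le, Set.singleton_subset_iff]
      exact Phi0_ff r c h0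
    exact this
  let Φ1 := Ideal.Quotient.lift (Ideal.span {ffPoly p F (r + 1) c}) (Phi0 (p := p) r c) hvan
  have hinj : Function.Injective Φ1 :=
    RingHom.lift_injective_of_ker_le_ideal _ hvan (Phi0_ker r c haniso)
  have hdom : IsDomain (MvPolynomial (Fin (r + 1)) F ⧸ Ideal.span {ffPoly p F (r + 1) c}) :=
    hinj.isDomain Φ1
  let Φ : ffRing p F (r + 1) c →+* FractionRing (MvPolynomial (Fin r) F) :=
    IsFractionRing.lift hinj
  have hΦ : ∀ x, Φ (algebraMap _ _ x) = Φ1 x := fun x => IsFractionRing.lift_algebraMap hinj x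
  have hmem1 : ∀ x, Φ1 x ∈ IntermediateField.adjoin (KK p r F) {tt r c} := by
    intro x
    obtain ⟨g, rfl⟩ := Ideal.Quotient.mk_surjective x
    exact Phi0_mem r c g
  have hfin := finish p Φ (fun i => ffMap p F (r + 1) c (c i)) (ee r c)
    (algebraMap (MvPolynomial (Fin r) F) _ (MvPolynomial.C (c 0))) (by
      rw [Ne, map_eq_zero_iff _ (IsFractionRing.injective _ _)]
      simpa using h0) (fun i => by
      rw [← C_mul_ee r c h0]
      exact (hΦ _).trans (Phi0_C r c (c i)))
    (IntermediateField.adjoin (KK p r F) {tt r c}) (by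
      intro x
      obtain ⟨a, b, hb, rfl⟩ := IsFractionRing.div_surjective
        (A := MvPolynomial (Fin (r + 1)) F ⧸ Ideal.span {ffPoly p F (r + 1) c}) x
      rw [map_div₀, hΦ, hΦ]
      exact div_mem (hmem1 a) (hmem1 b))
  exact (Nat.add_le_add_left (rank_bound r c haniso k hk) _).trans hfin

end final
end QL

/-- Let `φ` be an anisotropic quasilinear `p`-form of dimension
`d + 1 > 1` over a field `F` of characteristic `p`, and write
`dim φ = p^k + m` with `k ≥ 0` and `1 ≤ m ≤ p^{k+1} − p^k`.  Then `i₁(φ) ≤ m`,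
where `i₁(φ) = i₀(φ_{F(φ)})`. -/
theorem stmt15 {p : ℕ} [Fact p.Prime] (F : Type u) [Field F] [CharP F p]
    (d : ℕ) (hd : 0 < d) (c : Fin (d + 1) → F)
    (haniso : ∀ x : Fin (d + 1) → F, ∑ i, c i * x i ^ p = 0 → x = 0)
    (k m : ℕ) (hm1 : 1 ≤ m) (hm2 : m ≤ p ^ (k + 1) - p ^ k)
    (hdim : d + 1 = p ^ k + m) :
    i1 p F d c ≤ m := by
  obtain ⟨r, rfl⟩ : ∃ r, d = r + 1 := ⟨d - 1, by omega⟩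
  have h := QL.main r c haniso k (by omega)
  omega
end

section
/- Let p = 2 and φ an anisotropic quasilinear quadratic form of dimension > 1 over a field F of characteristic 2, with dim φ = 2^n + m for n ≥ 0 and 1 ≤ m ≤ 2^n. Let L be a field extension of F. If i₀(φ_L) < m, then i₀(φ_L) ≤ m − i₁(φ). -/
open scoped BigOperators

universe u

variable (p : ℕ)

set_option linter.style.haveILetI false
set_option linter.unusedSectionVars false


set_option linter.style.haveILetI false
set_option linter.unusedSectionVars false
namespace QL
open Module

section single
variable {R E : Type*} [Field R] [Field E] [Algebra R E] {ι : Type*} [Fintype ι]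

/-- the span of the coefficients -/
def V (R : Type*) {E ι : Type*} [Field R] [Field E] [Algebra R E] (a : ι → E) : Submodule R E :=
  Submodule.span R (Set.range a)

/-- `V + bV` -/
def M (R : Type*) {E ι : Type*} [Field R] [Field E] [Algebra R E] (a : ι → E) (b : E) :
    Submodule R E :=
  V R a ⊔ (V R a).map (LinearMap.mulLeft R b)

/-- `{u ∈ V | bu ∈ V}` -/
def U (R : Type*) {E ι : Type*} [Field R] [Field E] [Algebra R E] (a : ι → E) (b : E) :
    Submodule R E :=
  V R a ⊓ (V R a).comap (LinearMap.mulLeft R b)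

instance (a : ι → E) : FiniteDimensional R (V R a) :=
  FiniteDimensional.span_of_finite R (Set.finite_range a)

instance (a : ι → E) (b : E) : FiniteDimensional R (M R a b) := by
  unfold M; infer_instance

instance (a : ι → E) (b : E) : FiniteDimensional R (U R a b) := by
  unfold U; infer_instance

lemma finrank_V (a : ι → E) (b : E) (hb : b ≠ 0) :
    2 * finrank R (V R a) = finrank R (M R a b) + finrank R (U R a b) := by
  have hinj : Function.Injective (LinearMap.mulLeft R b) := by
    intro x y h
    simpa [hb] using h
  have h1 := Submodule.finrank_sup_add_finrank_inf_eq (V R a) ((V R a).map (LinearMap.mulLeft R b))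
  have h2 : finrank R ((V R a).map (LinearMap.mulLeft R b)) = finrank R (V R a) :=
    (LinearEquiv.finrank_eq (Submodule.equivMapOfInjective _ hinj _)).symm
  have h3 : (V R a) ⊓ ((V R a).map (LinearMap.mulLeft R b)) =
      (U R a b).map (LinearMap.mulLeft R b) := by
    unfold U
    ext x
    simp only [Submodule.mem_inf, Submodule.mem_map, Submodule.mem_comap]
    constructor
    · rintro ⟨h, y, hy, rfl⟩
      exact ⟨y, ⟨hy, h⟩, rfl⟩
    · rintro ⟨y, ⟨hy, h⟩, rfl⟩
      exact ⟨h, y, hy, rfl⟩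
  have h4 : finrank R ((U R a b).map (LinearMap.mulLeft R b)) = finrank R (U R a b) :=
    (LinearEquiv.finrank_eq (Submodule.equivMapOfInjective _ hinj _)).symm
  rw [h3, h4, h2] at h1
  unfold M
  omega

/-- a subalgebra all of whose elements have squares in the base field -/
def toIF (A : Subalgebra R E) (h : ∀ x ∈ A, x ^ 2 ∈ Set.range (algebraMap R E)) :
    IntermediateField R E :=
  A.toIntermediateField (by
    intro x hx
    obtain ⟨r, hr⟩ := h x hx
    by_cases h0 : x = 0
    · simp [h0]
    have : x⁻¹ = r⁻¹ • x := by
      rw [Algebra.smul_def, map_inv₀, hr]; field_simp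
    rw [this]
    exact A.smul_mem hx _)

lemma mem_toIF (A : Subalgebra R E) (h) (x : E) : x ∈ toIF A h ↔ x ∈ A := Iff.rfl

lemma pow_two_finrank [CharP E 2] (S : IntermediateField R E)
    (h : ∀ x ∈ S, x ^ 2 ∈ Set.range (algebraMap R E)) [FiniteDimensional R S] :
    ∃ r, finrank R S = 2 ^ r := by
  haveI : CharP R 2 := (algebraMap R E).charP (algebraMap R E).injective 2
  haveI : ExpChar R 2 := ExpChar.prime Nat.prime_two
  haveI : IsPurelyInseparable R S := by
    rw [isPurelyInseparable_iff_pow_mem R 2]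
    intro x
    obtain ⟨r, hr⟩ := h x x.2
    refine ⟨1, r, ?_⟩
    apply Subtype.ext
    simpa using hr
  exact IsPurelyInseparable.finrank_eq_pow R S 2

lemma sq_range_M [CharP E 2] {a : ι → E} {b : E}
    (ha : ∀ i, a i ^ 2 ∈ Set.range (algebraMap R E)) (hb : b ^ 2 ∈ Set.range (algebraMap R E)) :
    ∀ x ∈ M R a b, x ^ 2 ∈ Set.range (algebraMap R E) := by
  let W : Submodule R E :=
    { carrier := {x | x ^ 2 ∈ Set.range (algebraMap R E)}
      add_mem' := by
        rintro x y ⟨r, hr⟩ ⟨s, hs⟩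
        exact ⟨r + s, by rw [map_add, hr, hs, add_pow_char]⟩
      zero_mem' := ⟨0, by simp⟩
      smul_mem' := by
        rintro c x ⟨r, hr⟩
        exact ⟨c ^ 2 * r, by rw [map_mul, hr, Algebra.smul_def, mul_pow, map_pow]⟩ }
  have hV : V R a ≤ W := by
    unfold V
    rw [Submodule.span_le]
    rintro _ ⟨i, rfl⟩
    exact ha i
  have : M R a b ≤ W := by
    unfold M
    refine sup_le hV ?_
    rintro _ ⟨y, hy, rfl⟩
    obtain ⟨r, hr⟩ := hV hy
    obtain ⟨s, hs⟩ := hb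
    exact ⟨s * r, by simp [hr, hs, mul_pow]⟩
  exact this

lemma mul_b_mem {a : ι → E} {b : E} (hb : b ^ 2 ∈ Set.range (algebraMap R E)) {x : E}
    (hx : x ∈ M R a b) : b * x ∈ M R a b := by
  unfold M at *
  obtain ⟨y, hy, z, hz, rfl⟩ := Submodule.mem_sup.1 hx
  obtain ⟨w, hw, rfl⟩ := hz
  obtain ⟨r, hr⟩ := hb
  have : b * (y + (LinearMap.mulLeft R b) w) = r • w + (LinearMap.mulLeft R b) y := by
    rw [Algebra.smul_def, hr]; simp; ring
  rw [this]
  exact Submodule.add_mem_sup (Submodule.smul_mem _ _ hw) ⟨y, hy, rfl⟩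

/-- stabilizer -/
def Stab (N : Submodule R E) : Subalgebra R E where
  carrier := {s | ∀ m ∈ N, s * m ∈ N}
  mul_mem' := by
    intro x y hx hy m hm
    rw [mul_assoc]
    exact hx _ (hy _ hm)
  add_mem' := by
    intro x y hx hy m hm
    rw [add_mul]
    exact N.add_mem (hx _ hm) (hy _ hm)
  algebraMap_mem' := by
    intro r m hm
    rw [← Algebra.smul_def]
    exact N.smul_mem _ hm

/-- All single-level data. -/
lemma single_level [CharP E 2] {a : ι → E} {b : E} (i0 : ι) (hi0 : a i0 = 1)
    (ha : ∀ i, a i ^ 2 ∈ Set.range (algebraMap R E)) (hb : b ^ 2 ∈ Set.range (algebraMap R E))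
    (hD : ∀ u ∈ U R a b, ∀ i, a i * u ∈ M R a b) :
    ∃ S : IntermediateField R E, FiniteDimensional R S ∧
      (∀ x ∈ S, x ^ 2 ∈ Set.range (algebraMap R E)) ∧
      (∀ x ∈ U R a b, x ∈ S) ∧ (∀ s ∈ S, ∀ m ∈ M R a b, s * m ∈ M R a b) := by
  have h1 : (1 : E) ∈ M R a b := by
    unfold M V
    apply Submodule.mem_sup_left
    exact Submodule.subset_span ⟨i0, hi0⟩
  have hSM : ∀ x ∈ Stab (M R a b), x ∈ M R a b := by
    intro x hx
    simpa using hx 1 h1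
  have hsq : ∀ x ∈ Stab (M R a b), x ^ 2 ∈ Set.range (algebraMap R E) :=
    fun x hx => sq_range_M ha hb x (hSM x hx)
  refine ⟨toIF (Stab (M R a b)) hsq, ?_, hsq, ?_, fun s hs => hs⟩
  · exact FiniteDimensional.of_injective
      (Submodule.inclusion (p := Subalgebra.toSubmodule (Stab (M R a b))) (p' := M R a b) hSM)
      (Submodule.inclusion_injective _)
  · intro u hu m hm
    have key : ∀ v ∈ V R a, v * u ∈ M R a b := by
      intro v hv
      unfold V at hv
      induction hv using Submodule.span_induction with
      | mem x hx => obtain ⟨i, rfl⟩ := hx; exact hD u hu i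
      | zero => simp
      | add x y _ _ hx hy => rw [add_mul]; exact Submodule.add_mem _ hx hy
      | smul r x _ hx => rw [smul_mul_assoc]; exact Submodule.smul_mem _ _ hx
    have hm' := hm
    unfold M at hm'
    obtain ⟨y, hy, z, hz, rfl⟩ := Submodule.mem_sup.1 hm'
    obtain ⟨w, hw, rfl⟩ := hz
    rw [show u * (y + (LinearMap.mulLeft R b) w) = y * u + b * (w * u) by simp; ring]
    exact Submodule.add_mem _ (key y hy) (mul_b_mem hb (key w hw))

/-- the module `M` over the field `S` -/
def overS (S : IntermediateField R E) (N : Submodule R E)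
    (h : ∀ s ∈ S, ∀ m ∈ N, s * m ∈ N) : Submodule S E where
  carrier := N
  add_mem' := N.add_mem
  zero_mem' := N.zero_mem
  smul_mem' := fun s m hm => h s s.2 m hm

lemma finrank_overS (S : IntermediateField R E) (N : Submodule R E)
    (h : ∀ s ∈ S, ∀ m ∈ N, s * m ∈ N) :
    finrank R S * finrank S (overS S N h) = finrank R N :=
  Module.finrank_mul_finrank R S (overS S N h)

lemma finrank_tower (S : IntermediateField R E) (X : Submodule S E) :
    finrank R S * finrank S X = finrank R X :=
  Module.finrank_mul_finrank R S X

lemma fd_tower (S : IntermediateField R E) (X : Submodule S E) [FiniteDimensional R S]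
    [FiniteDimensional S X] : FiniteDimensional R X :=
  Module.Finite.trans S X

lemma hoffmann [CharP E 2] {a : ι → E} {b : E} (hb0 : b ≠ 0) (i0 : ι) (hi0 : a i0 = 1)
    (ha : ∀ i, a i ^ 2 ∈ Set.range (algebraMap R E)) (hb : b ^ 2 ∈ Set.range (algebraMap R E))
    (hD : ∀ u ∈ U R a b, ∀ i, a i * u ∈ M R a b) (n : ℕ) (hn : 2 ^ n < finrank R (V R a)) :
    2 ^ (n + 1) ≤ finrank R (M R a b) := by
  obtain ⟨S, hfd, hsq, hU, hM⟩ := single_level i0 hi0 ha hb hD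
  obtain ⟨r, hr⟩ := pow_two_finrank S hsq
  have h1 := finrank_overS S _ hM
  have h2 := finrank_V (R := R) a b hb0
  have h3 : finrank R (U R a b) ≤ finrank R S :=
    Submodule.finrank_mono (s := U R a b) (t := Subalgebra.toSubmodule S.toSubalgebra) hU
  have h4 : 2 ^ n < finrank R (M R a b) :=
    lt_of_lt_of_le hn (Submodule.finrank_mono le_sup_left)
  rw [hr] at h1 h3
  set q := finrank S (overS S _ hM)
  by_contra hlt
  push Not at hlt
  by_cases hrn : r ≤ n + 1
  · obtain ⟨j, hj⟩ := Nat.exists_eq_add_of_le hrn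
    have e : 2 ^ (n + 1) = 2 ^ r * 2 ^ j := by rw [← pow_add, hj]
    rw [← h1, e] at hlt
    have hq : q + 1 ≤ 2 ^ j := lt_of_mul_lt_mul_left hlt (Nat.zero_le _)
    have := Nat.mul_le_mul_left (2 ^ r) hq
    rw [← e] at this
    rw [mul_add, h1] at this
    have := pow_succ 2 n
    omega
  · push Not at hrn
    have : 2 ^ (n + 1) ≤ 2 ^ r := Nat.pow_le_pow_right (by norm_num) hrn.le
    have hq : 0 < q := by
      rcases Nat.eq_zero_or_pos q with h | h
      · rw [h] at h1; omega
      · exact h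
    have := Nat.mul_le_mul_left (2 ^ r) hq
    omega

end single

section two

lemma finrank_span_le {k K E : Type*} [Field k] [Field K] [Field E] [Algebra k K] [Algebra k E]
    [Algebra K E] [IsScalarTower k K E] (X : Submodule k E) [FiniteDimensional k X] :
    finrank K (Submodule.span K (X : Set E)) ≤ finrank k X := by
  classical
  let B := Module.finBasis k X
  have hle : Submodule.span K (X : Set E) ≤ Submodule.span K (Set.range fun i => (B i : E)) := by
    rw [Submodule.span_le]
    intro x hx
    have h := B.sum_repr ⟨x, hx⟩
    have h' : x = ∑ i, (B.repr ⟨x, hx⟩ i) • (B i : E) := by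
      have h'' := congrArg (Subtype.val) h
      refine h''.symm.trans ?_
      rw [Submodule.coe_sum]
      rfl
    rw [h']
    refine Submodule.sum_mem _ fun i _ => ?_
    rw [← algebraMap_smul K]
    exact Submodule.smul_mem _ _ (Submodule.subset_span ⟨i, rfl⟩)
  haveI : FiniteDimensional K (Submodule.span K (Set.range fun i => (B i : E))) :=
    FiniteDimensional.span_of_finite K (Set.finite_range _)
  refine (Submodule.finrank_mono hle).trans ?_
  refine (finrank_range_le_card _).trans ?_
  simp

lemma fd_span {k K E : Type*} [Field k] [Field K] [Field E] [Algebra k K] [Algebra k E]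
    [Algebra K E] [IsScalarTower k K E] (X : Submodule k E) [FiniteDimensional k X] :
    FiniteDimensional K (Submodule.span K (X : Set E)) := by
  obtain ⟨s, hs⟩ := (Submodule.fg_iff_finiteDimensional X).2 inferInstance
  have : Submodule.span K (X : Set E) = Submodule.span K (s : Set E) := by
    rw [← hs, Submodule.span_span_of_tower]
  rw [this]
  exact FiniteDimensional.span_of_finite K s.finite_toSet

variable {k K E : Type*} [Field k] [Field K] [Field E] [Algebra k K] [Algebra k E]
    [Algebra K E] [IsScalarTower k K E] [CharP E 2] {ι : Type*} [Fintype ι]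

theorem core_s16 {a : ι → E} {b : E} (hb0 : b ≠ 0) (i0 : ι) (hi0 : a i0 = 1)
    (ha : ∀ i, a i ^ 2 ∈ Set.range (algebraMap k E)) (hb : b ^ 2 ∈ Set.range (algebraMap k E))
    (hK : ∀ x : E, x ^ 2 ∈ Set.range (algebraMap K E))
    (hDk : ∀ u ∈ U k a b, ∀ i, a i * u ∈ M k a b)
    (hDK : ∀ u ∈ U K a b, ∀ i, a i * u ∈ M K a b)
    (N n i₁ : ℕ) (hN : finrank k (V k a) = N) (hM : finrank k (M k a b) ≤ 2 * (N - i₁))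
    (h1 : 1 ≤ i₁) (h1N : i₁ ≤ N) (hNn : N ≤ 2 ^ (n + 1))
    (hV : 2 ^ n < finrank K (V K a)) :
    2 ^ n + i₁ ≤ finrank K (V K a) := by
  have hMK := hoffmann hb0 i0 hi0 (fun i => hK _) (hK _) hDK n hV
  obtain ⟨S, hfd, hsq, hU, hMS⟩ := single_level i0 hi0 ha hb hDk
  obtain ⟨r, hr⟩ := pow_two_finrank S hsq
  -- the composite field
  have hadj : Subalgebra.toSubmodule (Algebra.adjoin K (S : Set E)) =
      Submodule.span K (S : Set E) := by
    rw [Algebra.adjoin_eq_span]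
    congr 1
    exact congrArg _ (Submonoid.closure_eq S.toSubalgebra.toSubmonoid)
  let SL : IntermediateField K E := toIF (Algebra.adjoin K (S : Set E)) (fun x _ => hK x)
  have hSSL : ∀ x ∈ S, x ∈ SL := fun x hx => Algebra.subset_adjoin hx
  have hfdspan : FiniteDimensional K (Submodule.span K (S : Set E)) :=
    fd_span (k := k) (Subalgebra.toSubmodule S.toSubalgebra)
  have hfdSL : FiniteDimensional K SL := by
    change FiniteDimensional K (Subalgebra.toSubmodule (Algebra.adjoin K (S : Set E)))
    rw [hadj]; exact hfdspan
  have hSLrank : finrank K SL = finrank K (Submodule.span K (S : Set E)) := by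
    change finrank K (Subalgebra.toSubmodule (Algebra.adjoin K (S : Set E))) = _
    rw [hadj]
  obtain ⟨j, hj⟩ := pow_two_finrank SL (fun x _ => hK x)
  have hle : finrank K SL ≤ finrank k S := by
    rw [hSLrank]
    exact finrank_span_le (k := k) (Subalgebra.toSubmodule S.toSubalgebra)
  have hVk := finrank_V (R := k) a b hb0
  have hVK := finrank_V (R := K) a b hb0
  have hVkK : ∀ x ∈ V k a, x ∈ V K a := fun x hx =>
    Submodule.span_le_restrictScalars k K _ hx
  rcases hle.eq_or_lt with heq | hlt
  · -- good case
    have hspanU : Submodule.span K (U k a b : Set E) ≤ U K a b := by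
      rw [Submodule.span_le]
      intro x hx
      exact ⟨hVkK _ hx.1, hVkK _ hx.2⟩
    have hUle : finrank k (U k a b) ≤ finrank K (Submodule.span K (U k a b : Set E)) := by
      let Sm : Submodule k E := Subalgebra.toSubmodule S.toSubalgebra
      haveI : FiniteDimensional k Sm := hfd
      let U' : Submodule k Sm := (U k a b).comap Sm.subtype
      obtain ⟨C, hC⟩ := Submodule.exists_isCompl U'
      have e1 := Submodule.finrank_add_eq_of_isCompl hC
      have e2 : finrank k U' = finrank k (U k a b) :=
        LinearEquiv.finrank_eq (Submodule.comapSubtypeEquivOfLe (p := U k a b) (q := Sm) hU)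
      let C' : Submodule k E := C.map Sm.subtype
      have e3 : finrank k C' = finrank k C :=
        (LinearEquiv.finrank_eq (Submodule.equivMapOfInjective _ Sm.injective_subtype _)).symm
      have e4 : Submodule.span K (S : Set E) ≤
          Submodule.span K (U k a b : Set E) ⊔ Submodule.span K (C' : Set E) := by
        rw [Submodule.span_le]
        intro x hx
        have : (⟨x, hx⟩ : Sm) ∈ U' ⊔ C := by rw [hC.sup_eq_top]; trivial
        obtain ⟨y, hy, z, hz, hyz⟩ := Submodule.mem_sup.1 this
        have : x = (y : E) + (z : E) := by
          rw [← Submodule.coe_add, hyz]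
        rw [this]
        exact Submodule.add_mem_sup (Submodule.subset_span hy)
          (Submodule.subset_span ⟨z, hz, rfl⟩)
      haveI := fd_span (K := K) (U k a b)
      haveI := fd_span (K := K) C'
      have e5 := Submodule.finrank_mono e4
      have e6 := Submodule.finrank_add_le_finrank_add_finrank
        (Submodule.span K (U k a b : Set E)) (Submodule.span K (C' : Set E))
      have e7 := finrank_span_le (K := K) C'
      have e8 : finrank k Sm = finrank k S := rfl
      omega
    have h5 := Submodule.finrank_mono hspanU
    have := pow_succ 2 n
    omega
  · exfalso
    -- bad case
    have hdrop : 2 * finrank K SL ≤ finrank k S := by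
      rw [hj, hr] at *
      have : j < r := (Nat.pow_lt_pow_iff_right (by norm_num)).1 hlt
      rw [← pow_succ']
      exact Nat.pow_le_pow_right (by norm_num) this
    have hover := finrank_overS S _ hMS
    let f : S →+* SL :=
      { toFun := fun x => ⟨x, hSSL x x.2⟩
        map_one' := rfl
        map_mul' := fun _ _ => rfl
        map_zero' := rfl
        map_add' := fun _ _ => rfl }
    letI : Algebra S SL := f.toAlgebra
    haveI : IsScalarTower S SL E := IsScalarTower.of_algebraMap_eq (fun x => rfl)
    haveI : FiniteDimensional S (overS S _ hMS) := by
      have : FiniteDimensional k (overS S _ hMS) :=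
        inferInstanceAs (FiniteDimensional k (M k a b))
      exact Module.Finite.right k S _
    have g1 := finrank_span_le (K := SL) (overS S _ hMS)
    haveI g2 := fd_span (K := SL) (overS S _ hMS)
    set X := Submodule.span SL ((overS S _ hMS : Submodule S E) : Set E) with hX
    have g3 : finrank K SL * finrank SL X = finrank K X := finrank_tower SL X
    have g4 : M K a b ≤ X.restrictScalars K := by
      have hk : ∀ x ∈ M k a b, x ∈ X := fun x hx => Submodule.subset_span hx
      unfold M
      refine sup_le ?_ ?_
      · unfold V
        rw [Submodule.span_le]
        rintro _ ⟨i, rfl⟩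
        exact hk _ (Submodule.mem_sup_left (Submodule.subset_span ⟨i, rfl⟩))
      · unfold V
        rw [Submodule.map_span_le]
        rintro _ ⟨i, rfl⟩
        exact hk _ (Submodule.mem_sup_right ⟨_, Submodule.subset_span ⟨i, rfl⟩, rfl⟩)
    haveI : FiniteDimensional K X := fd_tower SL X
    haveI : FiniteDimensional K (X.restrictScalars K) := this
    have g5 : finrank K (M K a b) ≤ finrank K X := Submodule.finrank_mono g4
    have g6 : finrank K SL * finrank SL X ≤ finrank K SL * finrank S (overS S _ hMS) :=
      Nat.mul_le_mul_left _ g1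
    have g7 := Nat.mul_le_mul_right (finrank S (overS S _ hMS)) hdrop
    rw [hover, mul_assoc] at g7
    have := pow_succ 2 n
    omega

end two
end QL

namespace QL
open Module MvPolynomial

section poly
variable {L : Type*} [Field L] [CharP L 2] {σ ι : Type*} [Fintype ι]

lemma sq_expand (f : MvPolynomial σ L) : f ^ 2 = expand 2 (map (frobenius L 2) f) := by
  rw [← map_frobenius_expand (p := 2) (f := f), map_expand]

lemma sum_sq_expand (a : ι → L) (f : ι → MvPolynomial σ L) :
    ∑ i, C (a i) * f i ^ 2 = expand 2 (∑ i, C (a i) * map (frobenius L 2) (f i)) := by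
  simp [sq_expand]

/-- common denominators -/
lemma clear_denom {κ : Type*} [Finite κ] (y : κ → FractionRing (MvPolynomial σ L)) :
    ∃ (h : MvPolynomial σ L) (f : κ → MvPolynomial σ L), h ≠ 0 ∧
      ∀ i, y i = algebraMap _ (FractionRing (MvPolynomial σ L)) (f i) /
        algebraMap _ (FractionRing (MvPolynomial σ L)) h := by
  obtain ⟨h, hh⟩ := IsLocalization.exist_integer_multiples_of_finite
    (nonZeroDivisors (MvPolynomial σ L)) y
  choose f hf using hh
  have h0 : (h : MvPolynomial σ L) ≠ 0 := nonZeroDivisors.coe_ne_zero h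
  refine ⟨h, f, h0, fun i => ?_⟩
  have h1 : algebraMap _ (FractionRing (MvPolynomial σ L)) (h : MvPolynomial σ L) ≠ 0 := by
    simpa using h0
  rw [hf, Algebra.smul_def]
  field_simp

lemma aniso_frac (a : ι → L) (ha : ∀ y : ι → L, ∑ i, a i * y i ^ 2 = 0 → y = 0)
    (y : ι → FractionRing (MvPolynomial σ L))
    (hy : ∑ i, algebraMap L (FractionRing (MvPolynomial σ L)) (a i) * y i ^ 2 = 0) : y = 0 := by
  obtain ⟨h, f, h0, hf⟩ := clear_denom y
  have h1 : algebraMap _ (FractionRing (MvPolynomial σ L)) h ≠ 0 := by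
    simpa using h0
  have e1 : ∑ i, C (a i) * f i ^ 2 = 0 := by
    apply IsFractionRing.injective (MvPolynomial σ L) (FractionRing (MvPolynomial σ L))
    have : algebraMap _ (FractionRing (MvPolynomial σ L)) (∑ i, C (a i) * f i ^ 2) =
        (algebraMap _ (FractionRing (MvPolynomial σ L)) h) ^ 2 *
        ∑ i, algebraMap L (FractionRing (MvPolynomial σ L)) (a i) * y i ^ 2 := by
      rw [map_sum, Finset.mul_sum]
      refine Finset.sum_congr rfl fun i _ => ?_
      rw [hf, IsScalarTower.algebraMap_apply L (MvPolynomial σ L) (FractionRing _),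
        MvPolynomial.algebraMap_eq, map_mul, map_pow]
      field_simp
    rw [this, hy]; simp
  rw [sum_sq_expand, expand_eq_zero (by norm_num)] at e1
  have e2 : ∀ i, f i = 0 := by
    intro i
    ext m
    have := congrArg (coeff m) e1
    simp only [coeff_sum, coeff_C_mul, coeff_map, coeff_zero, frobenius_def] at this
    have := congrFun (ha (fun i => coeff m (f i)) this) i
    simpa using this
  funext i
  simp [hf, e2]

variable [Fintype σ]

lemma deriv_poly (a : ι → L) (i1 : ι) (s : σ → ι) (f g : ι → MvPolynomial σ L)
    (h : ∑ i, C (a i) * g i ^ 2 =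
      (C (a i1) + ∑ j, C (a (s j)) * X j ^ 2) * ∑ i, C (a i) * f i ^ 2) (j : σ) :
    ∑ i, C (a i) * (pderiv j (g i)) ^ 2 = C (a (s j)) * ∑ i, C (a i) * f i ^ 2 +
      (C (a i1) + ∑ j, C (a (s j)) * X j ^ 2) * ∑ i, C (a i) * (pderiv j (f i)) ^ 2 := by
  classical
  have hB : (C (a i1) + ∑ j, C (a (s j)) * X j ^ 2 : MvPolynomial σ L) =
      expand 2 (C (a i1) + ∑ j, C (a (s j)) * X j) := by simp
  rw [hB] at h ⊢
  simp only [sum_sq_expand] at h ⊢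
  rw [← map_mul] at h
  have h' := expand_injective (by norm_num) h
  have hd := congrArg (pderiv j) h'
  have hBd : pderiv j (C (a i1) + ∑ j, C (a (s j)) * X j : MvPolynomial σ L) = C (a (s j)) := by
    simp [Derivation.leibniz, pderiv_X, Pi.single_apply]
  have hsum : ∀ f : ι → MvPolynomial σ L,
      pderiv j (∑ i, C (a i) * map (frobenius L 2) (f i)) =
      ∑ i, C (a i) * map (frobenius L 2) (pderiv j (f i)) := by
    intro f
    simp [Derivation.leibniz, pderiv_map]
  rw [Derivation.leibniz, hsum, hsum, hBd] at hd
  rw [hd]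
  simp only [smul_eq_mul, map_add, map_mul, expand_C]
  ring

lemma deriv_frac (a : ι → L) (i1 : ι) (s : σ → ι) (x : σ → FractionRing (MvPolynomial σ L))
    (hx : ∀ j, x j = algebraMap (MvPolynomial σ L) _ (X j))
    (α : ι → FractionRing (MvPolynomial σ L)) (hα : ∀ i, α i = algebraMap L _ (a i))
    (y z : ι → FractionRing (MvPolynomial σ L))
    (h : ∑ i, α i * z i ^ 2 =
      (α i1 + ∑ j, α (s j) * x j ^ 2) * ∑ i, α i * y i ^ 2) (j : σ) :
    ∃ w w' : ι → FractionRing (MvPolynomial σ L), 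
     ∑ i, α i * w i ^ 2 = α (s j) * ∑ i, α i * y i ^ 2 +
      (α i1 + ∑ j, α (s j) * x j ^ 2) * ∑ i, α i * w' i ^ 2 := by
  obtain ⟨t, f, h0, hf⟩ := clear_denom (Sum.elim y z)
  let A := algebraMap (MvPolynomial σ L) (FractionRing (MvPolynomial σ L))
  have hA : ∀ p, algebraMap (MvPolynomial σ L) (FractionRing (MvPolynomial σ L)) p = A p :=
    fun _ => rfl
  have h1 : A t ≠ 0 := by
    simpa [A] using h0
  have hα' : ∀ i, α i = A (C (a i)) := by
    intro i
    rw [hα, IsScalarTower.algebraMap_apply L (MvPolynomial σ L) (FractionRing _),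
        MvPolynomial.algebraMap_eq]
  have hy : ∀ i, y i = A (f (Sum.inl i)) / A t := fun i => hf (Sum.inl i)
  have hz : ∀ i, z i = A (f (Sum.inr i)) / A t := fun i => hf (Sum.inr i)
  have hsum : ∀ g : ι → MvPolynomial σ L, ∑ i, α i * (A (g i) / A t) ^ 2 =
      A (∑ i, C (a i) * g i ^ 2) / A t ^ 2 := by
    intro g
    rw [map_sum, Finset.sum_div]
    refine Finset.sum_congr rfl fun i _ => ?_
    rw [hα', map_mul, map_pow]; field_simp
  have hb : α i1 + ∑ j, α (s j) * x j ^ 2 = A (C (a i1) + ∑ j, C (a (s j)) * X j ^ 2) := by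
    simp [hα', hx, hA]
  rw [hb] at h ⊢
  simp only [hy, hz, hsum] at h ⊢
  have hp : ∑ i, C (a i) * (f (Sum.inr i)) ^ 2 =
      (C (a i1) + ∑ j, C (a (s j)) * X j ^ 2) * ∑ i, C (a i) * f (Sum.inl i) ^ 2 := by
    apply IsFractionRing.injective (MvPolynomial σ L) (FractionRing (MvPolynomial σ L))
    change A _ = A _
    rw [map_mul]
    field_simp at h
    exact h
  have := deriv_poly a i1 s _ _ hp j
  refine ⟨fun i => A (pderiv j (f (Sum.inr i))) / A t,
    fun i => A (pderiv j (f (Sum.inl i))) / A t, ?_⟩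
  simp only [hsum]
  rw [this, map_add, map_mul, map_mul, hα']
  field_simp

end poly

/-- Copy of `E` acting through Frobenius. -/
def Sq (E : Type*) := E

noncomputable instance (E : Type*) [Field E] : Field (Sq E) := inferInstanceAs (Field E)

noncomputable instance instAlgSq (F E : Type*) [Field F] [Field E] [Algebra F E] [CharP F 2] :
    Algebra (Sq F) E :=
  ((algebraMap F E).comp (frobenius F 2) : F →+* E).toAlgebra

noncomputable instance instAlgSqSq (F E : Type*) [Field F] [Field E] [Algebra F E] :
    Algebra (Sq F) (Sq E) :=
  (algebraMap F E : F →+* E).toAlgebra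

instance (F E : Type*) [Field F] [Field E] [Algebra F E] [CharP F 2] [CharP E 2] :
    IsScalarTower (Sq F) (Sq E) E :=
  IsScalarTower.of_algebraMap_eq (fun x => by
    exact map_pow (algebraMap F E) (show F from x) 2)

lemma sq_smul {F E : Type*} [Field F] [Field E] [Algebra F E] [CharP F 2] (y : F) (x : E) :
    (show Sq F from y) • x = x * algebraMap F E y ^ 2 := by
  rw [Algebra.smul_def]
  change algebraMap F E (y ^ 2) * x = _
  rw [map_pow, mul_comm]

lemma sq_smul' {F E : Type*} [Field F] [Field E] [Algebra F E] [CharP F 2] (y : Sq F) (x : E) :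
    y • x = x * algebraMap F E (show F from y) ^ 2 := sq_smul (F := F) y x

lemma mem_V_sq {F E ι : Type*} [Field F] [Field E] [Algebra F E] [CharP F 2] [Fintype ι]
    (a : ι → E) (x : E) :
    x ∈ V (Sq F) a ↔ ∃ y : ι → F, x = ∑ i, a i * algebraMap F E (y i) ^ 2 := by
  unfold V
  rw [Submodule.mem_span_range_iff_exists_fun]
  constructor
  · rintro ⟨y, hy⟩
    exact ⟨y, by rw [← hy]; exact Finset.sum_congr rfl fun i _ => sq_smul' _ _⟩
  · rintro ⟨y, hy⟩
    exact ⟨y, by rw [hy]; exact Finset.sum_congr rfl fun i _ => sq_smul _ _⟩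

lemma mem_range_sq {F E : Type*} [Field F] [Field E] [Algebra F E] [CharP F 2] (y : F) :
    (algebraMap F E y) ^ 2 ∈ Set.range (algebraMap (Sq F) E) :=
  ⟨(show Sq F from y), by
    change algebraMap F E (y ^ 2) = _
    rw [map_pow]⟩

/-- Elementwise derivation property implies the submodule one. -/
lemma hD_of {F E ι σ : Type*} [Field F] [Field E] [Algebra F E] [CharP F 2] [CharP E 2]
    [Fintype ι] [Fintype σ]
    (a : ι → F) (x : σ → F) (i0 i1 : ι) (s : σ → ι) (hs : ∀ i, i = i0 ∨ i = i1 ∨ ∃ j, i = s j)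
    (h0 : a i0 = 1)
    (hD : ∀ y z : ι → F, ∑ i, a i * z i ^ 2 =
      (a i1 + ∑ j, a (s j) * x j ^ 2) * ∑ i, a i * y i ^ 2 → ∀ j, ∃ w w' : ι → F,
      ∑ i, a i * w i ^ 2 = a (s j) * ∑ i, a i * y i ^ 2 +
      (a i1 + ∑ j, a (s j) * x j ^ 2) * ∑ i, a i * w' i ^ 2) :
    ∀ u ∈ U (Sq F) (fun i => algebraMap F E (a i))
        (algebraMap F E (a i1 + ∑ j, a (s j) * x j ^ 2)),
      ∀ i, algebraMap F E (a i) * u ∈ M (Sq F) (fun i => algebraMap F E (a i))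
        (algebraMap F E (a i1 + ∑ j, a (s j) * x j ^ 2)) := by
  intro u hu
  set b := a i1 + ∑ j, a (s j) * x j ^ 2 with hb
  have hVM : V (Sq F) (fun i => algebraMap F E (a i)) ≤
    M (Sq F) (fun i => algebraMap F E (a i)) (algebraMap F E b) := le_sup_left
  have hj : ∀ j, algebraMap F E (a (s j)) * u ∈ M (Sq F) (fun i => algebraMap F E (a i))
        (algebraMap F E b) := by
    intro j
    obtain ⟨y, hy⟩ := (mem_V_sq _ _).1 hu.1
    obtain ⟨z, hz⟩ := (mem_V_sq _ _).1 hu.2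
    have e : ∑ i, a i * z i ^ 2 = b * ∑ i, a i * y i ^ 2 := by
      apply (algebraMap F E).injective
      simp only [map_sum, map_mul, map_pow]
      rw [← hy]
      exact hz.symm
    obtain ⟨w, w', hw⟩ := hD y z e j
    have e2 : algebraMap F E (a (s j)) * u =
        (∑ i, algebraMap F E (a i) * algebraMap F E (w i) ^ 2) +
        algebraMap F E b * (∑ i, algebraMap F E (a i) * algebraMap F E (w' i) ^ 2) := by
      have := congrArg (algebraMap F E) hw
      rw [map_add, map_mul, map_mul] at this
      simp only [map_sum, map_mul, map_pow] at this
      rw [hy, this, add_assoc, CharTwo.add_self_eq_zero, add_zero]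
    rw [e2]
    exact Submodule.add_mem_sup ((mem_V_sq _ _).2 ⟨w, rfl⟩)
      ⟨_, (mem_V_sq _ _).2 ⟨w', rfl⟩, rfl⟩
  intro i
  rcases hs i with rfl | rfl | ⟨j, rfl⟩
  · rw [h0, map_one, one_mul]
    exact hVM hu.1
  · have : algebraMap F E (a i) * u = algebraMap F E b * u -
        ∑ j, (show Sq F from x j) • (algebraMap F E (a (s j)) * u) := by
      simp only [sq_smul]
      rw [hb, map_add, add_mul, map_sum, Finset.sum_mul, add_sub_assoc]
      symm
      rw [add_eq_left, sub_eq_zero]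
      refine Finset.sum_congr rfl fun j _ => ?_
      rw [map_mul, map_pow]; ring
    rw [this]
    exact Submodule.sub_mem _ (hVM hu.2)
      (Submodule.sum_mem _ fun j _ => Submodule.smul_mem _ _ (hj j))
  · exact hj j

/-- abstract assembly -/
theorem assembly {F E ι σ : Type*} [Field F] [Field E] [Algebra F E] [CharP F 2] [CharP E 2]
    [Fintype ι] [Fintype σ]
    (a : ι → F) (x : σ → F) (i0 i1 : ι) (s : σ → ι) (hs : ∀ i, i = i0 ∨ i = i1 ∨ ∃ j, i = s j)
    (h0 : a i0 = 1) (b : F) (hb : b = a i1 + ∑ j, a (s j) * x j ^ 2) (hb0 : b ≠ 0)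
    (hD : ∀ y z : ι → F, ∑ i, a i * z i ^ 2 =
      (a i1 + ∑ j, a (s j) * x j ^ 2) * ∑ i, a i * y i ^ 2 → ∀ j, ∃ w w' : ι → F,
      ∑ i, a i * w i ^ 2 = a (s j) * ∑ i, a i * y i ^ 2 +
      (a i1 + ∑ j, a (s j) * x j ^ 2) * ∑ i, a i * w' i ^ 2)
    (a' : ι → E) (ha' : ∀ i, a' i = algebraMap F E (a i))
    (x' : σ → E) (hx' : ∀ i, x' i = algebraMap F E (x i))
    (hD' : ∀ y z : ι → E, ∑ i, a' i * z i ^ 2 =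
      (a' i1 + ∑ j, a' (s j) * x' j ^ 2) * ∑ i, a' i * y i ^ 2 → ∀ j, ∃ w w' : ι → E,
      ∑ i, a' i * w i ^ 2 = a' (s j) * ∑ i, a' i * y i ^ 2 +
      (a' i1 + ∑ j, a' (s j) * x' j ^ 2) * ∑ i, a' i * w' i ^ 2)
    (hani : ∀ y : ι → F, ∑ i, a i * y i ^ 2 = 0 → y = 0)
    (n i₁ r : ℕ) (hr : r + i₁ = Fintype.card ι) (e : Fin r → ι)
    (he : ∀ i, ∃ y z : Fin r → F, a i = ∑ j, a (e j) * (y j ^ 2 + b * z j ^ 2))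
    (h1 : 1 ≤ i₁) (hNn : Fintype.card ι ≤ 2 ^ (n + 1))
    (hV : 2 ^ n < finrank (Sq E) (V (Sq E) a')) :
    2 ^ n + i₁ ≤ finrank (Sq E) (V (Sq E) a') := by
  have hE : ∀ x : E, x ^ 2 ∈ Set.range (algebraMap (Sq E) E) := fun x => mem_range_sq (E := E) x
  obtain rfl : a' = fun i => algebraMap F E (a i) := funext ha'
  obtain rfl : x' = fun i => algebraMap F E (x i) := funext hx'
  have hb' : algebraMap F E b = (algebraMap F E (a i1)) +
    ∑ j, algebraMap F E (a (s j)) * (algebraMap F E (x j)) ^ 2 := by rw [hb]; simp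
  refine core_s16 (k := Sq F) (K := Sq E) (E := E) (b := algebraMap F E b)
    (by simpa using hb0) i0 (by simp [h0])
    (fun i => mem_range_sq _) (mem_range_sq _) hE ?_ ?_ (Fintype.card ι) n i₁ ?_ ?_ h1
    (by omega) hNn hV
  · rw [hb]
    exact hD_of a x i0 i1 s hs h0 hD
  · rw [hb']
    exact hD_of (F := E) (E := E) _ _ i0 i1 s hs (by simp [h0]) hD'
  · unfold V
    apply finrank_span_eq_card
    rw [Fintype.linearIndependent_iff]
    intro g hg
    have : ∑ i, a i * (show F from g i) ^ 2 = 0 := by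
      apply (algebraMap F E).injective
      rw [map_zero, ← hg, map_sum]
      refine Finset.sum_congr rfl fun i _ => ?_
      rw [sq_smul', map_mul, map_pow]
    intro i
    exact congrFun (hani _ this) i
  · let v : Fin r ⊕ Fin r → E := Sum.elim (fun j => algebraMap F E (a (e j)))
      (fun j => algebraMap F E b * algebraMap F E (a (e j)))
    have hle : M (Sq F) (fun i => algebraMap F E (a i)) (algebraMap F E b) ≤
        Submodule.span (Sq F) (Set.range v) := by
      have hl : ∀ j, algebraMap F E (a (e j)) ∈ Submodule.span (Sq F) (Set.range v) :=
        fun j => Submodule.subset_span ⟨Sum.inl j, rfl⟩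
      have hrr : ∀ j, algebraMap F E b * algebraMap F E (a (e j)) ∈
        Submodule.span (Sq F) (Set.range v) :=
        fun j => Submodule.subset_span ⟨Sum.inr j, rfl⟩
      unfold M
      refine sup_le ?_ ?_
      · unfold V
        rw [Submodule.span_le]
        rintro _ ⟨i, rfl⟩
        obtain ⟨y, z, hyz⟩ := he i
        have : algebraMap F E (a i) = ∑ j, ((show Sq F from y j) • algebraMap F E (a (e j)) +
          (show Sq F from z j) • (algebraMap F E b * algebraMap F E (a (e j)))) := by
          rw [hyz, map_sum]
          refine Finset.sum_congr rfl fun j _ => ?_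
          rw [sq_smul, sq_smul]
          simp only [map_mul, map_add, map_pow]
          ring
        change algebraMap F E (a i) ∈ _
        rw [this]
        exact Submodule.sum_mem _ fun j _ => Submodule.add_mem _ (Submodule.smul_mem _ _ (hl j))
          (Submodule.smul_mem _ _ (hrr j))
      · unfold V
        rw [Submodule.map_span_le]
        rintro _ ⟨i, rfl⟩
        obtain ⟨y, z, hyz⟩ := he i
        have : algebraMap F E b * algebraMap F E (a i) =
          ∑ j, ((show Sq F from (b * z j)) • algebraMap F E (a (e j)) +
          (show Sq F from y j) • (algebraMap F E b * algebraMap F E (a (e j)))) := by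
          rw [hyz, map_sum, Finset.mul_sum]
          refine Finset.sum_congr rfl fun j _ => ?_
          rw [sq_smul, sq_smul]
          simp only [map_mul, map_add, map_pow]
          ring
        change algebraMap F E b * algebraMap F E (a i) ∈ _
        rw [this]
        exact Submodule.sum_mem _ fun j _ => Submodule.add_mem _ (Submodule.smul_mem _ _ (hl j))
          (Submodule.smul_mem _ _ (hrr j))
    haveI : FiniteDimensional (Sq F) (Submodule.span (Sq F) (Set.range v)) :=
      FiniteDimensional.span_of_finite _ (Set.finite_range _)
    refine (Submodule.finrank_mono hle).trans ((finrank_range_le_card v).trans ?_)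
    simp
    omega

end QL

namespace QL
open Module MvPolynomial

section defect

lemma defectIdx_scale {K : Type*} [CommRing K] {ι : Type} [Fintype ι] (a c : ι → K) (t : K)
    (ht : IsUnit t) (h : ∀ i, c i = t * a i) : defectIdx 2 K c = defectIdx 2 K a := by
  unfold defectIdx
  have : {x : ι → K | ∑ i, c i * x i ^ 2 = 0} = {x : ι → K | ∑ i, a i * x i ^ 2 = 0} := by
    ext x
    simp only [Set.mem_ofPred_eq, h, mul_assoc, ← Finset.mul_sum]
    exact ht.mul_right_eq_zero
  rw [this]

lemma defectIdx_add {E : Type*} [Field E] [CharP E 2] {ι : Type} [Fintype ι] (a : ι → E) :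
    finrank (Sq E) (V (Sq E) a) + defectIdx 2 E a = Fintype.card ι := by
  have h := LinearMap.finrank_range_add_finrank_ker (Fintype.linearCombination (Sq E) a)
  rw [Fintype.range_linearCombination, Module.finrank_fintype_fun_eq_card] at h
  rw [← h]
  unfold V
  congr 1
  let T : Submodule E (ι → E) :=
    { carrier := {x : ι → E | ∑ i, a i * x i ^ 2 = 0}
      add_mem' := by
        intro x y hx hy
        have hx' : ∑ i, a i * x i ^ 2 = 0 := hx
        have hy' : ∑ i, a i * y i ^ 2 = 0 := hy
        change ∑ i, a i * (x i + y i) ^ 2 = 0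
        simp only [add_pow_char, mul_add, Finset.sum_add_distrib, hx', hy', add_zero]
      zero_mem' := by
        change ∑ i, a i * (0 : E) ^ 2 = 0
        simp
      smul_mem' := by
        intro r x hx
        have hx' : ∑ i, a i * x i ^ 2 = 0 := hx
        change ∑ i, a i * (r * x i) ^ 2 = 0
        have : ∑ i, a i * (r * x i) ^ 2 = r ^ 2 * ∑ i, a i * x i ^ 2 := by
          rw [Finset.mul_sum]
          exact Finset.sum_congr rfl fun i _ => by ring
        rw [this, hx', mul_zero] }
  have hT : Submodule.span E {x : ι → E | ∑ i, a i * x i ^ 2 = 0} = T := Submodule.span_eq T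
  unfold defectIdx
  rw [hT]
  have hmem : ∀ x : ι → E, x ∈ T ↔
      (show ι → Sq E from x) ∈ LinearMap.ker (Fintype.linearCombination (Sq E) a) := by
    intro x
    rw [LinearMap.mem_ker, Fintype.linearCombination_apply]
    have e : ∑ i, (show ι → Sq E from x) i • a i = ∑ i, a i * x i ^ 2 :=
      Finset.sum_congr rfl fun i _ => sq_smul (F := E) (E := E) (x i) (a i)
    constructor
    · intro hx
      exact e.trans hx
    · intro hx
      exact e.symm.trans hx
  let j : T ≃+ LinearMap.ker (Fintype.linearCombination (Sq E) a) :=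
    { toFun := fun x => ⟨x.1, (hmem x.1).1 x.2⟩
      invFun := fun x => ⟨x.1, (hmem x.1).2 x.2⟩
      left_inv := fun _ => rfl
      right_inv := fun _ => rfl
      map_add' := fun _ _ => rfl }
  have := rank_eq_of_equiv_equiv (R := E) (R' := Sq E) (fun x => x) j Function.bijective_id
    (fun r m => rfl)
  exact congrArg Cardinal.toNat this

end defect

section trans
variable {L : Type*} [Field L] [CharP L 2] {σ : Type*} {ι : Type} [Fintype ι]

instance : CharP (FractionRing (MvPolynomial σ L)) 2 :=
  charP_of_injective_algebraMap
    (algebraMap L (FractionRing (MvPolynomial σ L))).injective 2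

lemma finrank_frac (a : ι → L) :
    finrank (Sq (FractionRing (MvPolynomial σ L))) (V (Sq (FractionRing (MvPolynomial σ L)))
      (fun i => algebraMap L (FractionRing (MvPolynomial σ L)) (a i))) =
    finrank (Sq L) (V (Sq L) a) := by
  set E := FractionRing (MvPolynomial σ L)
  haveI : FiniteDimensional (Sq L) (Submodule.span (Sq L) (Set.range a)) :=
    FiniteDimensional.span_of_finite _ (Set.finite_range a)
  obtain ⟨v, hv1, hv2, hv3⟩ := Submodule.exists_fun_fin_finrank_span_eq (Sq L) (Set.range a)
  have key : V (Sq E) (fun i => algebraMap L E (a i)) =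
      V (Sq E) (fun j => algebraMap L E (v j)) := by
    unfold V
    apply le_antisymm
    · rw [Submodule.span_le]
      rintro _ ⟨i, rfl⟩
      have : a i ∈ V (Sq L) v := by
        unfold V
        rw [hv2]
        exact Submodule.subset_span ⟨i, rfl⟩
      obtain ⟨y, hy⟩ := (mem_V_sq (F := L) _ _).1 this
      refine (mem_V_sq (F := E) _ _).2 ⟨fun j => algebraMap L E (y j), ?_⟩
      change algebraMap L E (a i) = _
      rw [hy]
      simp
    · rw [Submodule.span_le]
      rintro _ ⟨j, rfl⟩
      obtain ⟨i, hi⟩ := hv1 j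
      exact Submodule.subset_span ⟨i, by simp [hi]⟩
  rw [key]
  unfold V
  rw [finrank_span_eq_card, Fintype.card_fin]
  rw [Fintype.linearIndependent_iff] at hv3 ⊢
  intro g hg i
  refine congrFun (aniso_frac (σ := σ) v ?_ g ?_) i
  · intro y hy
    funext j
    refine hv3 y ?_ j
    rw [← hy]
    exact Finset.sum_congr rfl fun i _ => sq_smul (F := L) (E := L) (y i) (v i)
  · rw [← hg]
    refine Finset.sum_congr rfl fun i _ => (sq_smul' (F := E) (E := E) (g i) _).symm

end trans

section irr
variable {F : Type*} [Field F] [CharP F 2]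

lemma irreducible_ffPoly (d : ℕ) (hd : 0 < d) (c : Fin (d + 1) → F)
    (haniso : ∀ x : Fin (d + 1) → F, ∑ i, c i * x i ^ 2 = 0 → x = 0) :
    Irreducible (ffPoly 2 F d c) := by
  classical
  let Ω := AlgebraicClosure F
  have hc : ∀ i, c i ≠ 0 := by
    intro i hi
    have := haniso (Pi.single i 1) (by simp [Pi.single_apply, hi])
    simpa using congrFun this i
  haveI : CharP Ω 2 := charP_of_injective_algebraMap (algebraMap F Ω).injective 2
  have hs : ∀ i, ∃ z : Ω, z ^ 2 = algebraMap F Ω (c i) := fun i =>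
    IsAlgClosed.exists_pow_nat_eq _ (by norm_num)
  choose s hs using hs
  have hs0 : ∀ i, s i ≠ 0 := by
    intro i h
    have := hs i
    rw [h] at this
    apply hc i
    apply (algebraMap F Ω).injective
    rw [← this]; simp
  let l : MvPolynomial (Fin d) Ω := C (s (Fin.last d)) + ∑ i : Fin d, C (s i.castSucc) * X i
  have hl : map (algebraMap F Ω) (ffPoly 2 F d c) = l ^ 2 := by
    simp only [ffPoly, l]
    rw [add_pow_char, sum_pow_char]
    simp [mul_pow, ← C_pow, hs]
  have hl0 : coeff 0 l = s (Fin.last d) := by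
    simp [l, coeff_sum, coeff_C_mul]
  have hlj : ∀ j, coeff (Finsupp.single j 1) l = s (Fin.castSucc j) := by
    intro j
    simp only [l, coeff_add, coeff_sum, coeff_C_mul, coeff_C, coeff_X]
    rw [Finset.sum_eq_single j]
    · have : (0 : Fin d →₀ ℕ) ≠ Finsupp.single j 1 := by
        intro h
        simpa using DFunLike.congr_fun h j
      simp [this]
    · intro i _ hij
      simp [Finsupp.single_left_inj, hij]
    · simp
  have hirr : Irreducible l := by
    apply irreducible_of_totalDegree_eq_one
    · apply le_antisymm
      · refine (totalDegree_add _ _).trans (max_le (by simp) ?_)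
        apply totalDegree_finsetSum_le
        intro i _
        refine (totalDegree_mul _ _).trans (by simp)
      · have : Finsupp.single (⟨0, hd⟩ : Fin d) 1 ∈ l.support := by
          rw [MvPolynomial.mem_support_iff, hlj]; exact hs0 _
        simpa using le_totalDegree this
    · intro x hx
      have := hx 0
      rw [hl0] at this
      exact isUnit_of_dvd_unit this (hs0 _).isUnit
  have hpr : Prime l := hirr.prime
  have hunit : ∀ f : MvPolynomial (Fin d) F, IsUnit (map (algebraMap F Ω) f) → IsUnit f := by
    intro f hf
    obtain ⟨r, hr, hfr⟩ := isUnit_iff_eq_C_of_isReduced.1 hf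
    rw [isUnit_iff_eq_C_of_isReduced]
    have h0 : algebraMap F Ω (coeff 0 f) = r := by
      have := congrArg (coeff 0) hfr
      rw [coeff_map, coeff_C] at this
      rw [this, if_pos rfl]
    refine ⟨coeff 0 f, ?_, ?_⟩
    · rw [isUnit_iff_ne_zero]
      intro h
      rw [h, map_zero] at h0
      exact hr.ne_zero h0.symm
    · apply map_injective _ (algebraMap F Ω).injective
      rw [hfr, map_C, h0]
  refine ⟨fun h => ?_, fun f g hfg => ?_⟩
  · have := h.map (map (algebraMap F Ω))
    rw [hl] at this
    exact hirr.not_isUnit (isUnit_pow_iff (by norm_num) |>.1 this)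
  · have hm : l ^ 2 = map (algebraMap F Ω) f * map (algebraMap F Ω) g := by
      rw [← hl, hfg, map_mul]
    obtain ⟨i, hi, hass⟩ := (dvd_prime_pow hpr 2).1 (Dvd.intro _ hm.symm)
    interval_cases i
    · left
      apply hunit
      rw [pow_zero] at hass
      exact associated_one_iff_isUnit.1 hass
    · exfalso
      obtain ⟨u, hu⟩ := hass
      rw [pow_one] at hu
      obtain ⟨r, hr, hru⟩ := (isUnit_iff_eq_C_of_isReduced).1 u.isUnit
      rw [hru, mul_comm] at hu
      let j : Fin d := ⟨0, hd⟩
      have e0 := congrArg (coeff 0) hu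
      have e1 := congrArg (coeff (Finsupp.single j 1)) hu
      rw [hl0, coeff_C_mul, coeff_map] at e0
      rw [hlj, coeff_C_mul, coeff_map] at e1
      set α := coeff 0 f
      set β := coeff (Finsupp.single j 1) f
      have e2 : c j.castSucc * α ^ 2 + c (Fin.last d) * β ^ 2 = 0 := by
        apply (algebraMap F Ω).injective
        simp only [map_add, map_mul, map_pow, map_zero, ← hs, ← e0, ← e1]
        have : (r * algebraMap F Ω β) ^ 2 * algebraMap F Ω α ^ 2 =
          (r * algebraMap F Ω α) ^ 2 * algebraMap F Ω β ^ 2 := by ring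
        rw [this, CharTwo.add_self_eq_zero]
      have hne : j.castSucc ≠ Fin.last d := (Fin.castSucc_lt_last j).ne
      have := haniso (fun i => if i = Fin.last d then β else if i = j.castSucc then α else 0) (by
        rw [Fin.sum_univ_castSucc, Finset.sum_eq_single j]
        · simpa [hne] using e2
        · intro i _ hij
          simp [(Fin.castSucc_lt_last i).ne, hij]
        · simp)
      have := congrFun this j.castSucc
      simp [hne] at this
      apply hs0 (Fin.last d)
      rw [← e0, this]; simp
    · right
      apply hunit
      obtain ⟨u, hu⟩ := hass
      have : map (algebraMap F Ω) g * (↑u⁻¹ : MvPolynomial (Fin d) Ω) = 1 := by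
        have hf0 : map (algebraMap F Ω) f ≠ 0 := by
          intro h
          rw [h, zero_mul] at hm
          exact hpr.ne_zero (pow_eq_zero_iff (by norm_num) |>.1 hm)
        apply mul_left_cancel₀ hf0
        rw [← mul_assoc, ← hm, ← hu, mul_assoc, Units.mul_inv]
      exact IsUnit.of_mul_eq_one _ this

end irr
end QL

namespace QL
open Module MvPolynomial

section link

/-- Elements whose square is the image of an element of the form `y² + b z²`. -/
def sqField {E K : Type*} [Field E] [Field K] [CharP E 2] [CharP K 2] (θ : E →+* K) (b : E) :
    Subfield K where
  carrier := {k | ∃ y z : E, k ^ 2 = θ (y ^ 2 + b * z ^ 2)}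
  mul_mem' := by
    rintro k k' ⟨y, z, h⟩ ⟨y', z', h'⟩
    refine ⟨y * y' + b * z * z', y * z' + y' * z, ?_⟩
    rw [mul_pow, h, h', ← map_mul, add_pow_char, add_pow_char]
    congr 1
    ring
  one_mem' := ⟨1, 0, by simp⟩
  add_mem' := by
    rintro k k' ⟨y, z, h⟩ ⟨y', z', h'⟩
    refine ⟨y + y', z + z', ?_⟩
    rw [add_pow_char, h, h', ← map_add, add_pow_char, add_pow_char]
    congr 1
    ring
  zero_mem' := ⟨0, 0, by simp⟩
  neg_mem' := by
    rintro k ⟨y, z, h⟩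
    exact ⟨y, z, by rw [neg_sq, h]⟩
  inv_mem' := by
    rintro k ⟨y, z, h⟩
    by_cases hk : k = 0
    · exact ⟨0, 0, by simp [hk]⟩
    refine ⟨y / (y ^ 2 + b * z ^ 2), z / (y ^ 2 + b * z ^ 2), ?_⟩
    have hw : y ^ 2 + b * z ^ 2 ≠ 0 := by
      intro h0
      rw [h0, map_zero] at h
      exact hk (pow_eq_zero_iff (by norm_num) |>.1 h)
    rw [inv_pow, h, ← map_inv₀]
    congr 1
    field_simp

lemma ne_zero_of_aniso {F : Type*} [Field F] {ι : Type*} [Fintype ι] (c : ι → F)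
    (haniso : ∀ x : ι → F, ∑ i, c i * x i ^ 2 = 0 → x = 0) (i : ι) : c i ≠ 0 := by
  classical
  intro hi
  have := haniso (Pi.single i 1) (by simp [Pi.single_apply, hi])
  simpa using congrFun this i

variable {F : Type u} [Field F] [CharP F 2]

/-- The transcendental coordinate subfield. -/
abbrev E0 (e : ℕ) (F : Type*) [Field F] := FractionRing (MvPolynomial (Fin e) F)

/-- The generic value. -/
noncomputable def bb {e : ℕ} (a : Fin (e + 2) → F) : E0 e F :=
  algebraMap F (E0 e F) (a (Fin.last (e + 1))) + ∑ j : Fin e,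
    algebraMap F (E0 e F) (a j.castSucc.castSucc) * algebraMap (MvPolynomial (Fin e) F) _ (X j) ^ 2

lemma link_aux {e : ℕ} {K : Type*} [Field K] [CharP K 2] (g : MvPolynomial (Fin (e + 1)) F →+* K)
    (c a : Fin (e + 2) → F) (h0 : c (Fin.last e).castSucc ≠ 0)
    (ha : ∀ i, a i = c i / c (Fin.last e).castSucc)
    (hker : ∀ f, g f = 0 ↔ ffPoly 2 F (e + 1) c ∣ f)
    (hfrac : ∀ k : K, ∃ f f', k = g f / g f') :
    ∃ θ : E0 e F →+* K, (∀ t : F, θ (algebraMap F _ t) = g (C t)) ∧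
      ∀ k : K, ∃ y z : E0 e F, k ^ 2 = θ (y ^ 2 + bb a * z ^ 2) := by
  let g0 : MvPolynomial (Fin e) F →+* K := g.comp (rename Fin.castSucc).toRingHom
  have hg0 : Function.Injective g0 := by
    rw [injective_iff_map_eq_zero]
    intro f hf
    have hf' : g (rename Fin.castSucc f) = 0 := hf
    rw [hker] at hf'
    let Ω := AlgebraicClosure (E0 e F)
    haveI : CharP Ω 2 := charP_of_injective_algebraMap (algebraMap (E0 e F) Ω).injective 2
    obtain ⟨w, hw⟩ : ∃ w : Ω, w ^ 2 = algebraMap (E0 e F) Ω (bb a) :=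
      IsAlgClosed.exists_pow_nat_eq _ (by norm_num)
    let A : MvPolynomial (Fin e) F →+* Ω :=
      (algebraMap (E0 e F) Ω).comp (algebraMap (MvPolynomial (Fin e) F) (E0 e F))
    have hA : Function.Injective A := (algebraMap (E0 e F) Ω).injective.comp
      (IsFractionRing.injective (MvPolynomial (Fin e) F) (E0 e F))
    let pt : Fin (e + 1) → Ω := Fin.snoc (α := fun _ => Ω) (fun j => A (X j)) w
    let h : MvPolynomial (Fin (e + 1)) F →+* Ω := eval₂Hom (A.comp C) pt
    have hq : h (ffPoly 2 F (e + 1) c) = 0 := by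
      have hbb : w ^ 2 = A (C (a (Fin.last (e + 1)))) +
          ∑ j : Fin e, A (C (a j.castSucc.castSucc)) * A (X j) ^ 2 := by
        rw [hw, bb]
        simp only [map_add, map_sum, map_mul, map_pow]
        rfl
      have hc : ∀ i, c i = c (Fin.last e).castSucc * a i := by
        intro i; rw [ha]; field_simp
      simp only [ffPoly, map_add, map_sum, map_mul, map_pow]
      rw [Fin.sum_univ_castSucc]
      simp only [h, coe_eval₂Hom, eval₂_C, eval₂_X, RingHom.comp_apply]
      simp only [pt, Fin.snoc_castSucc, Fin.snoc_last]
      rw [hbb]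
      rw [hc (Fin.last (e + 1))]
      have : ∀ j : Fin e, A (C (c j.castSucc.castSucc)) =
          A (C (c (Fin.last e).castSucc)) * A (C (a j.castSucc.castSucc)) := by
        intro j
        rw [hc j.castSucc.castSucc, C_mul, map_mul]
      simp only [this, mul_assoc]
      rw [← Finset.mul_sum, C_mul, map_mul, ← add_assoc, ← mul_add]
      exact CharTwo.add_self_eq_zero (R := Ω) _
    obtain ⟨f', hf'⟩ := hf'
    have h1 : h (rename Fin.castSucc f) = 0 := by rw [hf', map_mul, hq, zero_mul]
    have h2 : h (rename Fin.castSucc f) = A f := by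
      have : h.comp (rename Fin.castSucc).toRingHom = A := by
        apply MvPolynomial.ringHom_ext
        · intro r; simp [h]
        · intro i; simp [h, pt]
      exact congrArg (fun φ => φ f) this
    apply hA
    rw [map_zero, ← h2, h1]
  let θ : E0 e F →+* K := IsFractionRing.lift hg0
  have hθ : ∀ f, θ (algebraMap (MvPolynomial (Fin e) F) _ f) = g (rename Fin.castSucc f) :=
    fun f => IsFractionRing.lift_algebraMap hg0 f
  have hθF : ∀ t : F, θ (algebraMap F _ t) = g (C t) := by
    intro t
    rw [IsScalarTower.algebraMap_apply F (MvPolynomial (Fin e) F) (E0 e F),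
        MvPolynomial.algebraMap_eq, hθ, rename_C]
  refine ⟨θ, hθF, ?_⟩
  have hgm : ∀ f, g f ∈ sqField θ (bb a) := by
    intro f
    induction f using MvPolynomial.induction_on with
    | C t => exact ⟨algebraMap F _ t, 0, by simp [hθF]⟩
    | add p q hp hq => rw [map_add]; exact add_mem hp hq
    | mul_X p i hp =>
      rw [map_mul]
      refine mul_mem hp ?_
      refine Fin.lastCases ?_ (fun j => ?_) i
      · refine ⟨0, 1, ?_⟩
        have hq : g (ffPoly 2 F (e + 1) c) = 0 := (hker _).2 dvd_rfl
        have hc : ∀ i, c i = c (Fin.last e).castSucc * a i := by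
          intro i; rw [ha]; field_simp
        simp only [ffPoly, map_add, map_sum, map_mul, map_pow] at hq
        rw [Fin.sum_univ_castSucc, ← add_assoc, CharTwo.add_eq_zero] at hq
        have h0' : g (C (c (Fin.last e).castSucc)) ≠ 0 := by
          have := (g.comp C).injective.ne h0
          simpa using this
        have : ∀ i, g (C (c i)) = g (C (c (Fin.last e).castSucc)) * g (C (a i)) := by
          intro j
          rw [hc j, C_mul, map_mul]
        apply mul_left_cancel₀ h0'
        rw [← hq]
        rw [this (Fin.last (e + 1)), Finset.sum_congr rfl (fun j _ => by
          rw [this (Fin.castSucc j.castSucc), mul_assoc]), ← Finset.mul_sum, ← mul_add]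
        congr 1
        simp only [bb, map_add, map_sum, map_mul, map_pow, hθF, hθ, rename_X]
        simp
      · exact ⟨algebraMap (MvPolynomial (Fin e) F) _ (X j), 0, by
          rw [map_add, map_pow, hθ, rename_X]; simp⟩
  intro k
  obtain ⟨f, f', rfl⟩ := hfrac k
  exact div_mem (hgm f) (hgm f')

lemma link_aux2 {e : ℕ} {K : Type*} [Field K] [CharP K 2] (g : MvPolynomial (Fin (e + 1)) F →+* K)
    (c a : Fin (e + 2) → F) (h0 : c (Fin.last e).castSucc ≠ 0)
    (ha : ∀ i, a i = c i / c (Fin.last e).castSucc)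
    (hker : ∀ f, g f = 0 ↔ ffPoly 2 F (e + 1) c ∣ f)
    (hfrac : ∀ k : K, ∃ f f', k = g f / g f') :
    ∃ (r : ℕ) (f : Fin r → Fin (e + 2)),
      r + defectIdx 2 K (fun i => g (C (c i))) = Fintype.card (Fin (e + 2)) ∧
      ∀ i, ∃ y z : Fin r → E0 e F, algebraMap F (E0 e F) (a i) =
        ∑ j, algebraMap F (E0 e F) (a (f j)) * (y j ^ 2 + bb a * z j ^ 2) := by
  obtain ⟨θ, hθ, hsq⟩ := link_aux g c a h0 ha hker hfrac
  let v0 : Fin (e + 2) → K := fun i => g (C (a i))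
  have hsc : defectIdx 2 K (fun i => g (C (c i))) = defectIdx 2 K v0 := by
    apply defectIdx_scale _ _ (g (C (c (Fin.last e).castSucc)))
    · rw [isUnit_iff_ne_zero]
      have := (g.comp C).injective.ne h0
      simpa using this
    · intro i
      change _ = _ * g (C (a i))
      rw [← map_mul, ← C_mul, ha]
      congr 2
      field_simp
  haveI : FiniteDimensional (Sq K) (Submodule.span (Sq K) (Set.range v0)) :=
    FiniteDimensional.span_of_finite _ (Set.finite_range v0)
  obtain ⟨v, hv1, hv2, hv3⟩ := Submodule.exists_fun_fin_finrank_span_eq (Sq K) (Set.range v0)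
  choose f hf using hv1
  refine ⟨_, f, ?_, ?_⟩
  · rw [hsc]
    exact defectIdx_add v0
  · intro i
    have : v0 i ∈ V (Sq K) v := by
      unfold V
      rw [hv2]
      exact Submodule.subset_span ⟨i, rfl⟩
    obtain ⟨k, hk⟩ := (mem_V_sq (F := K) _ _).1 this
    choose y z hyz using fun j => hsq (k j)
    refine ⟨y, z, ?_⟩
    apply θ.injective
    rw [hθ]
    change v0 i = _
    rw [hk, map_sum]
    refine Finset.sum_congr rfl fun j _ => ?_
    rw [map_mul, ← hyz, hθ, ← hf]
    rfl

lemma link {e : ℕ} (c a : Fin (e + 2) → F)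
    (haniso : ∀ x : Fin (e + 2) → F, ∑ i, c i * x i ^ 2 = 0 → x = 0)
    (ha : ∀ i, a i = c i / c (Fin.last e).castSucc) :
    ∃ (r : ℕ) (f : Fin r → Fin (e + 2)),
      r + i1 2 F (e + 1) c = Fintype.card (Fin (e + 2)) ∧
      ∀ i, ∃ y z : Fin r → E0 e F, algebraMap F (E0 e F) (a i) =
        ∑ j, algebraMap F (E0 e F) (a (f j)) * (y j ^ 2 + bb a * z j ^ 2) := by
  have hirr := irreducible_ffPoly (e + 1) (Nat.succ_pos e) c haniso
  haveI : (Ideal.span {ffPoly 2 F (e + 1) c}).IsPrime :=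
    (Ideal.span_singleton_prime hirr.ne_zero).2 hirr.prime
  let R := MvPolynomial (Fin (e + 1)) F ⧸ Ideal.span {ffPoly 2 F (e + 1) c}
  haveI : IsDomain R := Ideal.Quotient.isDomain _
  let K := FractionRing R
  let g : MvPolynomial (Fin (e + 1)) F →+* K := (algebraMap R K).comp (Ideal.Quotient.mk _)
  haveI : CharP K 2 := charP_of_injective_ringHom (g.comp C).injective 2
  refine link_aux2 (K := K) g c a (ne_zero_of_aniso c haniso _) ha ?_ ?_
  · intro f
    change algebraMap R K (Ideal.Quotient.mk _ f) = 0 ↔ _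
    rw [map_eq_zero_iff _ (IsFractionRing.injective R K), Ideal.Quotient.eq_zero_iff_mem,
      Ideal.mem_span_singleton]
  · intro k
    obtain ⟨x, y, hy, rfl⟩ := IsFractionRing.div_surjective (A := R) k
    obtain ⟨x, rfl⟩ := Ideal.Quotient.mk_surjective x
    obtain ⟨y, rfl⟩ := Ideal.Quotient.mk_surjective y
    exact ⟨x, y, rfl⟩

end link
end QL

namespace QL
open Module MvPolynomial

set_option maxHeartbeats 400000 in
theorem main_s16 {F L : Type u} [Field F] [CharP F 2] [Field L] [Algebra F L] (e : ℕ)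
    (c : Fin (e + 2) → F)
    (haniso : ∀ x : Fin (e + 2) → F, ∑ i, c i * x i ^ 2 = 0 → x = 0)
    (n m : ℕ) (hm2 : m ≤ 2 ^ n) (hdim : e + 2 = 2 ^ n + m)
    (hlt : defectIdx 2 L (fun i => algebraMap F L (c i)) < m) :
    defectIdx 2 L (fun i => algebraMap F L (c i)) ≤ m - i1 2 F (e + 1) c := by
  haveI : CharP L 2 := charP_of_injective_algebraMap (algebraMap F L).injective 2
  rcases Nat.eq_zero_or_pos (i1 2 F (e + 1) c) with h | hpos
  · rw [h]; exact hlt.le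
  have hc := ne_zero_of_aniso c haniso
  let i0 : Fin (e + 2) := (Fin.last e).castSucc
  let a : Fin (e + 2) → F := fun i => c i / c i0
  have hca : ∀ i, c i = c i0 * a i := by
    intro i
    have := hc i0
    simp only [a]
    field_simp
  have hani : ∀ y : Fin (e + 2) → F, ∑ i, a i * y i ^ 2 = 0 → y = 0 := by
    intro y hy
    apply haniso
    have : ∑ i, c i * y i ^ 2 = c i0 * ∑ i, a i * y i ^ 2 := by
      rw [Finset.mul_sum]
      exact Finset.sum_congr rfl fun i _ => by rw [hca i, mul_assoc]
    rw [this, hy, mul_zero]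
  have hsc : defectIdx 2 L (fun i => algebraMap F L (c i)) =
      defectIdx 2 L (fun i => algebraMap F L (a i)) := by
    apply defectIdx_scale _ _ (algebraMap F L (c i0))
    · rw [isUnit_iff_ne_zero]
      simpa using hc i0
    · intro i
      rw [← map_mul, ← hca]
  rw [hsc] at hlt ⊢
  have hadd := defectIdx_add (fun i => algebraMap F L (a i))
  obtain ⟨r, f, hr, hf⟩ := link c a haniso (fun i => rfl)
  let h0 : MvPolynomial (Fin e) F →+* E0 e L :=
    (algebraMap (MvPolynomial (Fin e) L) (E0 e L)).comp (map (algebraMap F L))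
  have hh0 : Function.Injective h0 :=
    (IsFractionRing.injective (MvPolynomial (Fin e) L) (E0 e L)).comp
      (map_injective _ (algebraMap F L).injective)
  let ρ : E0 e F →+* E0 e L := IsFractionRing.lift hh0
  have hρ : ∀ q, ρ (algebraMap (MvPolynomial (Fin e) F) _ q) =
      algebraMap (MvPolynomial (Fin e) L) (E0 e L) (map (algebraMap F L) q) :=
    fun q => IsFractionRing.lift_algebraMap hh0 q
  have hρF : ∀ t : F, ρ (algebraMap F _ t) = algebraMap L (E0 e L) (algebraMap F L t) := by
    intro t
    rw [IsScalarTower.algebraMap_apply F (MvPolynomial (Fin e) F) (E0 e F),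
      MvPolynomial.algebraMap_eq, hρ, map_C,
      IsScalarTower.algebraMap_apply L (MvPolynomial (Fin e) L) (E0 e L),
      MvPolynomial.algebraMap_eq]
  let aF : Fin (e + 2) → E0 e F := fun i => algebraMap F (E0 e F) (a i)
  let xF : Fin e → E0 e F := fun j => algebraMap (MvPolynomial (Fin e) F) (E0 e F) (X j)
  let aL : Fin (e + 2) → E0 e L := fun i => algebraMap L (E0 e L) (algebraMap F L (a i))
  let xL : Fin e → E0 e L := fun j => algebraMap (MvPolynomial (Fin e) L) (E0 e L) (X j)
  have hani' := aniso_frac (σ := Fin e) a hani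
  have hcover : ∀ i : Fin (e + 2), i = i0 ∨ i = Fin.last (e + 1) ∨
      ∃ j : Fin e, i = j.castSucc.castSucc := by
    intro i
    refine Fin.lastCases (Or.inr (Or.inl rfl)) (fun i => ?_) i
    refine Fin.lastCases (Or.inl rfl) (fun j => Or.inr (Or.inr ⟨j, rfl⟩)) i
  have hb0 : bb a ≠ 0 := by
    intro hb
    let y : Fin (e + 2) → E0 e F := Fin.snoc (α := fun _ => E0 e F)
      (Fin.snoc (α := fun _ => E0 e F)
        (fun j => algebraMap (MvPolynomial (Fin e) F) _ (X j)) 0) 1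
    have := congrFun (hani' y (by
      rw [← hb, bb, Fin.sum_univ_castSucc, Fin.sum_univ_castSucc]
      simp only [y, Fin.snoc_castSucc, Fin.snoc_last]
      ring)) (Fin.last (e + 1))
    simp [y] at this
  have hfr := finrank_frac (σ := Fin e) (fun i => algebraMap F L (a i))
  have hN : Fintype.card (Fin (e + 2)) = 2 ^ n + m := by rw [Fintype.card_fin, hdim]
  have hDF : ∀ y z : Fin (e + 2) → E0 e F, ∑ i, aF i * z i ^ 2 =
      (aF (Fin.last (e + 1)) + ∑ j : Fin e, aF j.castSucc.castSucc * xF j ^ 2) *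
        ∑ i, aF i * y i ^ 2 → ∀ j : Fin e, ∃ w w' : Fin (e + 2) → E0 e F,
      ∑ i, aF i * w i ^ 2 = aF j.castSucc.castSucc * ∑ i, aF i * y i ^ 2 +
      (aF (Fin.last (e + 1)) + ∑ j : Fin e, aF j.castSucc.castSucc * xF j ^ 2) *
        ∑ i, aF i * w' i ^ 2 := by
    intro y z h j
    exact deriv_frac a (Fin.last (e + 1)) (fun j : Fin e => j.castSucc.castSucc) xF
      (fun _ => rfl) aF (fun _ => rfl) y z h j
  have hDL : ∀ y z : Fin (e + 2) → E0 e L, ∑ i, aL i * z i ^ 2 =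
      (aL (Fin.last (e + 1)) + ∑ j : Fin e, aL j.castSucc.castSucc * xL j ^ 2) *
        ∑ i, aL i * y i ^ 2 → ∀ j : Fin e, ∃ w w' : Fin (e + 2) → E0 e L,
      ∑ i, aL i * w i ^ 2 = aL j.castSucc.castSucc * ∑ i, aL i * y i ^ 2 +
      (aL (Fin.last (e + 1)) + ∑ j : Fin e, aL j.castSucc.castSucc * xL j ^ 2) *
        ∑ i, aL i * w' i ^ 2 := by
    intro y z h j
    exact deriv_frac (fun i => algebraMap F L (a i)) (Fin.last (e + 1))
      (fun j : Fin e => j.castSucc.castSucc) xL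
      (fun _ => rfl) aL (fun _ => rfl) y z h j
  have haF : aF i0 = 1 := by simp [aF, a, hc i0]
  have hbb : bb a = aF (Fin.last (e + 1)) + ∑ j : Fin e, aF j.castSucc.castSucc * xF j ^ 2 := rfl
  have haL : ∀ i, aL i = ρ (aF i) := fun i => (hρF (a i)).symm
  have hxL : ∀ j, xL j = ρ (xF j) := fun j => by
    simp only [xL, xF]
    rw [hρ, map_X]
  have hfL : finrank (Sq (E0 e L)) (V (Sq (E0 e L)) aL) = finrank (Sq L)
    (V (Sq L) fun i => algebraMap F L (a i)) := hfr
  have hani'' : ∀ y : Fin (e + 2) → E0 e F, ∑ i, aF i * y i ^ 2 = 0 → y = 0 := hani'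
  have hf' : ∀ i, ∃ y z : Fin r → E0 e F, aF i =
        ∑ j, aF (f j) * (y j ^ 2 + bb a * z j ^ 2) := hf
  have hlt2 : 2 ^ n < finrank (Sq (E0 e L)) (V (Sq (E0 e L)) aL) := by rw [hfL]; omega
  have hN2 : Fintype.card (Fin (e + 2)) ≤ 2 ^ (n + 1) := by rw [hN, pow_succ]; omega
  clear_value ρ aF xF aL xL
  have key := @assembly (E0 e F) (E0 e L) (Fin (e + 2)) (Fin e) _ _ ρ.toAlgebra _ _ _ _ aF
    xF i0 (Fin.last (e + 1)) (fun j => j.castSucc.castSucc) hcover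
    haF (bb a) hbb hb0 hDF aL haL xL hxL hDL
    hani'' n (i1 2 F (e + 1) c) r hr f hf' hpos hN2 hlt2
  rw [hfL] at key
  omega

end QL

/-- (Outer excellent connections for quasilinear quadratic forms.)
Let `F` have characteristic `2` and `φ` be an anisotropic quasilinear quadratic form
of dimension `d + 1 > 1` over `F`, with `dim φ = 2^n + m`, `n ≥ 0`, `1 ≤ m ≤ 2^n`.
Let `L` be a field extension of `F`.  If `i₀(φ_L) < m`, then
`i₀(φ_L) ≤ m − i₁(φ)`, where `i₁(φ) = i₀(φ_{F(φ)})`. -/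
theorem stmt16 (F : Type u) [Field F] [CharP F 2]
    (d : ℕ) (hd : 0 < d) (c : Fin (d + 1) → F)
    (haniso : ∀ x : Fin (d + 1) → F, ∑ i, c i * x i ^ 2 = 0 → x = 0)
    (n m : ℕ) (hm1 : 1 ≤ m) (hm2 : m ≤ 2 ^ n)
    (hdim : d + 1 = 2 ^ n + m)
    (L : Type u) [Field L] [Algebra F L]
    (hlt : defectIdx 2 L (fun i => algebraMap F L (c i)) < m) :
    defectIdx 2 L (fun i => algebraMap F L (c i)) ≤ m - i1 2 F d c := by
  obtain ⟨e, rfl⟩ : ∃ e, d = e + 1 := ⟨d - 1, by omega⟩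
  exact QL.main_s16 e c haniso n m hm2 hdim hlt
end

section
/- Let φ be an anisotropic quasilinear p-form of dimension > 1 over a field F of characteristic p, and let n be the nonnegative integer with p^n < dim φ ≤ p^{n+1}. Then φ is a quasi-Pfister neighbour if and only if the height h(φ) equals n + 1, and in general h(φ) ≥ n + 1. -/
open scoped BigOperators

set_option synthInstance.maxHeartbeats 1600000
set_option maxHeartbeats 4000000

universe u

variable (p : ℕ)

/-- Value map of the diagonal quasilinear `p`-form with coefficients `b`. -/
def diagVal {K : Type u} [CommRing K] {ι : Type} [Fintype ι] (b : ι → K)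
    (x : ι → K) : K :=
  ∑ i, b i * x i ^ p

/-- A stage of the standard splitting tower: a field together with a diagonal
quasilinear `p`-form over it. -/
structure QLStage (p : ℕ) : Type (u + 1) where
  carrier : Type u
  [fld : Field carrier]
  dim : ℕ
  coeff : Fin dim → carrier

attribute [instance] QLStage.fld

/-- Coefficients of the quasi-Pfister form `⟪a₁,…,a_m⟫`. -/
def pfCoeff {F : Type u} [Field F] {p m : ℕ} (a : Fin m → F) : (Fin m → Fin p) → F :=
  fun e => ∏ i, a i ^ (e i : ℕ)

section helpers

theorem qp_pow_mem {K : Type u} [Field K] (y : K) :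
    y ^ p ∈ Subfield.closure (Set.range (fun z : K => z ^ p)) :=
  Subfield.subset_closure ⟨y, rfl⟩

/-- The subfield of `p`-th powers. -/
def qpP (K : Type u) [Field K] : Subfield K := Subfield.closure (Set.range (fun z : K => z ^ p))

/-- The set of ratios of a set. -/
def qpRatio {K : Type u} [Field K] (V : Set K) : Set K := {z | ∃ a ∈ V, ∃ b ∈ V, z = a / b}

/-- The norm field of a set of values. -/
def qpN {K : Type u} [Field K] (V : Set K) : Subfield K :=
  qpP p K ⊔ Subfield.closure (qpRatio V)

/-- The norm degree. -/
noncomputable def qpDeg {K : Type u} [Field K] (V : Set K) : ℕ :=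
  Subfield.relfinrank (qpP p K) (qpN p V)

theorem pow_mem_qpP {K : Type u} [Field K] (y : K) : y ^ p ∈ qpP p K :=
  Subfield.subset_closure ⟨y, rfl⟩

theorem mem_qpP_iff [Fact p.Prime] {K : Type u} [Field K] [CharP K p] (y : K) :
    y ∈ qpP p K ↔ ∃ z, z ^ p = y := by
  constructor
  · intro hy
    have : qpP p K ≤ (frobenius K p).fieldRange := by
      refine Subfield.closure_le.2 ?_
      rintro _ ⟨z, rfl⟩
      exact ⟨z, rfl⟩
    obtain ⟨z, hz⟩ := this hy
    exact ⟨z, hz⟩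
  · rintro ⟨z, rfl⟩
    exact pow_mem_qpP p z

theorem adj_toSubfield {K : Type u} [Field K] (A : Subfield K) (x : K) :
    (IntermediateField.adjoin A ({x} : Set K)).toSubfield = A ⊔ Subfield.closure {x} := by
  rw [IntermediateField.adjoin_toSubfield]
  rw [Subfield.closure_union]
  congr 1
  have : Set.range (algebraMap A K) = (A : Set K) := by
    ext y
    exact ⟨fun ⟨z, hz⟩ => hz ▸ z.2, fun hy => ⟨⟨y, hy⟩, rfl⟩⟩
  rw [this, Subfield.closure_eq]

theorem adj_relfinrank [Fact p.Prime] {K : Type u} [Field K] [CharP K p] (A : Subfield K) (x : K)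
    (hx : x ^ p ∈ A) (hxA : x ∉ A) :
    Subfield.relfinrank A (A ⊔ Subfield.closure {x}) = p := by
  have hp := (Fact.out : p.Prime)
  rw [Subfield.relfinrank_eq_finrank_of_le le_sup_left]
  have h1 : Subfield.extendScalars (le_sup_left : A ≤ A ⊔ Subfield.closure {x}) =
      IntermediateField.adjoin A ({x} : Set K) := by
    apply IntermediateField.toSubfield_injective
    rw [adj_toSubfield, Subfield.extendScalars_toSubfield]
  rw [h1]
  have hirr : Irreducible (Polynomial.X ^ p - Polynomial.C (⟨x ^ p, hx⟩ : A)) := by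
    apply X_pow_sub_C_irreducible_of_prime hp
    intro b hb
    apply hxA
    have : (b : K) ^ p = x ^ p := congrArg Subtype.val hb
    have : (b : K) = x := frobenius_inj K p this
    rw [← this]; exact b.2
  have hev : Polynomial.aeval x (Polynomial.X ^ p - Polynomial.C (⟨x ^ p, hx⟩ : A)) = 0 := by
    simp [Subfield.algebraMap_ofSubfield]
  have hmonic : (Polynomial.X ^ p - Polynomial.C (⟨x ^ p, hx⟩ : A)).Monic :=
    Polynomial.monic_X_pow_sub_C _ hp.ne_zero
  have hint : IsIntegral A x := ⟨_, hmonic, hev⟩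
  rw [IntermediateField.adjoin.finrank hint, ← minpoly.eq_of_irreducible_of_monic hirr hev hmonic,
    Polynomial.natDegree_X_pow_sub_C]

theorem adj_mem_sum [Fact p.Prime] {K : Type u} [Field K] (A : Subfield K) (x : K)
    (hx : x ^ p ∈ A) (y : K) (hy : y ∈ A ⊔ Subfield.closure {x}) :
    ∃ c : Fin p → K, (∀ j, c j ∈ A) ∧ y = ∑ j, c j * x ^ (j : ℕ) := by
  have hp := (Fact.out : p.Prime)
  have hev : Polynomial.aeval x (Polynomial.X ^ p - Polynomial.C (⟨x ^ p, hx⟩ : A)) = 0 := by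
    simp [Subfield.algebraMap_ofSubfield]
  have hmonic : (Polynomial.X ^ p - Polynomial.C (⟨x ^ p, hx⟩ : A)).Monic :=
    Polynomial.monic_X_pow_sub_C _ hp.ne_zero
  have hint : IsIntegral A x := ⟨_, hmonic, hev⟩
  rw [← adj_toSubfield] at hy
  have hy2 : y ∈ (IntermediateField.adjoin A ({x} : Set K)).toSubalgebra := hy
  rw [IntermediateField.adjoin_simple_toSubalgebra_of_isAlgebraic hint.isAlgebraic,
    Algebra.adjoin_singleton_eq_range_aeval] at hy2
  obtain ⟨g, hg⟩ := hy2
  set q := (Polynomial.X ^ p - Polynomial.C (⟨x ^ p, hx⟩ : A)) with hq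
  have hdeg : (g %ₘ q).natDegree < p := by
    have := Polynomial.natDegree_modByMonic_lt g hmonic (by
      intro h1
      have := congrArg Polynomial.natDegree h1
      rw [hq, Polynomial.natDegree_X_pow_sub_C] at this
      simp [hp.ne_zero] at this)
    rwa [hq, Polynomial.natDegree_X_pow_sub_C] at this
  refine ⟨fun j => ((g %ₘ q).coeff j : A), fun j => Subtype.property _, ?_⟩
  have h2 : Polynomial.aeval x g = Polynomial.aeval x (g %ₘ q) := by
    conv_lhs => rw [← Polynomial.modByMonic_add_div g q]
    simp [hev]
  have hg' : Polynomial.aeval x g = y := hg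
  rw [← hg', h2, Polynomial.aeval_eq_sum_range' hdeg, Finset.sum_range]
  rfl

theorem sup_closure_insert {K : Type u} [Field K] (A : Subfield K) (x : K) (s : Set K) :
    A ⊔ Subfield.closure (insert x s) = (A ⊔ Subfield.closure s) ⊔ Subfield.closure {x} := by
  rw [Set.insert_eq, Subfield.closure_union, sup_assoc, sup_comm (Subfield.closure s)]

theorem pf_surj [Fact p.Prime] {K : Type u} [Field K] : ∀ (m : ℕ) (a : Fin m → K) [CharP K p] (y : K),
    y ∈ qpP p K ⊔ Subfield.closure (Set.range a) →
    ∃ v : (Fin m → Fin p) → K, diagVal p (pfCoeff a) v = y := by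
  intro m
  induction m with
  | zero =>
    intro a _ y hy
    have h1 : Set.range a = ∅ := Set.range_eq_empty a
    rw [h1, Subfield.closure_empty, sup_bot_eq, mem_qpP_iff] at hy
    obtain ⟨z, hz⟩ := hy
    exact ⟨fun _ => z, by simp [diagVal, pfCoeff, hz]⟩
  | succ m ih =>
    intro a _ y hy
    obtain ⟨x, b, rfl⟩ : ∃ x b, a = Fin.cons x b := ⟨a 0, Fin.tail a, (Fin.cons_self_tail a).symm⟩
    rw [Fin.range_cons, sup_closure_insert] at hy
    obtain ⟨c, hc, rfl⟩ := adj_mem_sum p _ x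
      ((le_sup_left : qpP p K ≤ _) (pow_mem_qpP p x)) y hy
    choose v hv using fun j => ih b (c j) (hc j)
    refine ⟨fun e => v (e 0) (Fin.tail e), ?_⟩
    unfold diagVal
    rw [← (Fin.consEquiv (fun _ => Fin p)).sum_comp, Fintype.sum_prod_type]
    apply Finset.sum_congr rfl
    intro j _
    rw [← hv j, diagVal, Finset.sum_mul]
    apply Finset.sum_congr rfl
    intro e _
    simp [Fin.consEquiv, pfCoeff, Fin.prod_univ_succ]
    ring

theorem adj_relfinrank_le [Fact p.Prime] {K : Type u} [Field K] [CharP K p] (A : Subfield K)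
    (hA : qpP p K ≤ A) : ∀ (m : ℕ) (a : Fin m → K),
    Subfield.relfinrank A (A ⊔ Subfield.closure (Set.range a)) ∣ p ^ m := by
  intro m
  induction m with
  | zero =>
    intro a
    have h1 : Set.range a = ∅ := Set.range_eq_empty a
    rw [h1, Subfield.closure_empty, sup_bot_eq]; simp
  | succ m ih =>
    intro a
    obtain ⟨x, b, rfl⟩ : ∃ x b, a = Fin.cons x b := ⟨a 0, Fin.tail a, (Fin.cons_self_tail a).symm⟩
    rw [Fin.range_cons, sup_closure_insert]
    rw [← Subfield.relfinrank_mul_relfinrank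
      (le_sup_left : A ≤ A ⊔ Subfield.closure (Set.range b)) le_sup_left, pow_succ]
    apply mul_dvd_mul (ih b)
    by_cases hx : x ∈ A ⊔ Subfield.closure (Set.range b)
    · rw [Subfield.relfinrank_eq_one_of_le]
      · exact one_dvd _
      · simpa using hx
    · rw [adj_relfinrank p _ x ((hA.trans le_sup_left) (pow_mem_qpP p x)) hx]

theorem exists_pbasis [Fact p.Prime] {K : Type u} [Field K] [CharP K p]
    (s : Set K) (hs : s.Finite) : ∃ (m : ℕ) (a : Fin m → K),
      qpP p K ⊔ Subfield.closure s = qpP p K ⊔ Subfield.closure (Set.range a) ∧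
      Subfield.relfinrank (qpP p K) (qpP p K ⊔ Subfield.closure s) = p ^ m := by
  induction s, hs using Set.Finite.induction_on with
  | empty =>
    refine ⟨0, Fin.elim0, ?_, ?_⟩
    · rw [Set.range_eq_empty]
    · rw [Subfield.closure_empty, sup_bot_eq]; simp
  | @insert x s _ _ ih =>
    obtain ⟨m, a, h1, h2⟩ := ih
    by_cases hx : x ∈ qpP p K ⊔ Subfield.closure s
    · have : qpP p K ⊔ Subfield.closure (insert x s) = qpP p K ⊔ Subfield.closure s := by
        rw [sup_closure_insert]; simpa using hx
      exact ⟨m, a, by rw [this, h1], by rw [this, h2]⟩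
    · refine ⟨m + 1, Fin.cons x a, ?_, ?_⟩
      · rw [Fin.range_cons, sup_closure_insert, sup_closure_insert, h1]
      · rw [sup_closure_insert, ← Subfield.relfinrank_mul_relfinrank
          (le_sup_left : qpP p K ≤ qpP p K ⊔ Subfield.closure s) le_sup_left, h2,
          adj_relfinrank p _ x ((le_sup_left : qpP p K ≤ _) (pow_mem_qpP p x)) hx, pow_succ]

theorem qpN_eq_base {K : Type u} [Field K] (V : Set K) (v : K) (hv : v ∈ V) (hv0 : v ≠ 0) :
    qpN p V = qpP p K ⊔ Subfield.closure ((fun a => a / v) '' V) := by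
  apply le_antisymm
  · refine sup_le le_sup_left (Subfield.closure_le.2 ?_)
    rintro _ ⟨a, ha, b, hb, rfl⟩
    have h1 : ∀ a ∈ V, a / v ∈ qpP p K ⊔ Subfield.closure ((fun a => a / v) '' V) := fun a ha =>
      (le_sup_right : Subfield.closure _ ≤ _) (Subfield.subset_closure ⟨a, ha, rfl⟩)
    have := div_mem (h1 a ha) (h1 b hb)
    rwa [div_div_div_cancel_right₀ hv0] at this
  · refine sup_le le_sup_left ((Subfield.closure_mono ?_).trans le_sup_right)
    rintro _ ⟨a, ha, rfl⟩
    exact ⟨a, ha, v, hv, rfl⟩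

theorem mem_range_diagVal [Fact p.Prime] {K : Type u} [Field K] {m : ℕ} (b : Fin m → K)
    (i : Fin m) : b i ∈ Set.range (diagVal p b) := by
  have hp := (Fact.out : p.Prime)
  refine ⟨Pi.single i 1, ?_⟩
  unfold diagVal
  rw [Finset.sum_eq_single i]
  · simp
  · intro j _ hj
    simp [Pi.single_eq_of_ne hj, hp.ne_zero]
  · simp

theorem qpN_diag [Fact p.Prime] {K : Type u} [Field K] {m : ℕ} (b : Fin m → K)
    (j : Fin m) (hj : b j ≠ 0) : qpN p (Set.range (diagVal p b)) = qpN p (Set.range b) := by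
  rw [qpN_eq_base p _ (b j) (mem_range_diagVal p b j) hj, qpN_eq_base p (Set.range b) (b j) (Set.mem_range_self j) hj]
  apply le_antisymm
  · refine sup_le le_sup_left (Subfield.closure_le.2 ?_)
    rintro _ ⟨_, ⟨x, rfl⟩, rfl⟩
    simp only [diagVal, Finset.sum_div]
    refine sum_mem fun i _ => ?_
    rw [mul_div_right_comm]
    refine mul_mem ?_ ((le_sup_left : qpP p K ≤ _) (pow_mem_qpP p _))
    exact (le_sup_right : Subfield.closure _ ≤ _) (Subfield.subset_closure ⟨_, ⟨i, rfl⟩, rfl⟩)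
  · refine sup_le le_sup_left ((Subfield.closure_mono ?_).trans le_sup_right)
    rintro _ ⟨_, ⟨i, rfl⟩, rfl⟩
    exact ⟨_, mem_range_diagVal p b i, rfl⟩

theorem aniso_ne_zero [Fact p.Prime] {K : Type u} [Field K] {m : ℕ} (b : Fin m → K)
    (hb : ∀ x, diagVal p b x = 0 → x = 0) (i : Fin m) : b i ≠ 0 := by
  have hp := (Fact.out : p.Prime)
  intro h
  have h1 := hb (Pi.single i 1) (by
    unfold diagVal
    rw [Finset.sum_eq_single i]
    · simp [h]
    · intro j _ hj
      simp [Pi.single_eq_of_ne hj, hp.ne_zero]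
    · simp)
  have := congrFun h1 i
  simp at this

theorem aniso_dim_le [Fact p.Prime] {K : Type u} [Field K] [CharP K p] {m : ℕ} (b : Fin m → K)
    (j : Fin m) (hb : ∀ x, diagVal p b x = 0 → x = 0) (h0 : qpDeg p (Set.range b) ≠ 0) :
    m ≤ qpDeg p (Set.range b) := by
  have hj := aniso_ne_zero p b hb j
  have hle : qpP p K ≤ qpN p (Set.range b) := le_sup_left
  have hmem : ∀ i, b i / b j ∈ qpN p (Set.range b) := fun i =>
    (le_sup_right : Subfield.closure _ ≤ _)
      (Subfield.subset_closure ⟨_, ⟨i, rfl⟩, _, ⟨j, rfl⟩, rfl⟩)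
  unfold qpDeg at h0 ⊢
  rw [Subfield.relfinrank_eq_finrank_of_le hle] at h0 ⊢
  have hfin := Module.finite_of_finrank_pos (Nat.pos_of_ne_zero h0)
  have hli : LinearIndependent (qpP p K)
      (fun i => (⟨b i / b j, hmem i⟩ : Subfield.extendScalars hle)) := by
    rw [Fintype.linearIndependent_iff]
    intro g hg
    choose z hz using fun i => (mem_qpP_iff p (g i : K)).1 (g i).2
    have h1 : ∑ i, (g i : K) * (b i / b j) = 0 := by
      have := congrArg (Subtype.val) hg
      rw [AddSubmonoidClass.coe_finsetSum] at this
      exact this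
    have h2 : z = 0 := by
      apply hb
      have : diagVal p b z = b j * ∑ i, (g i : K) * (b i / b j) := by
        rw [diagVal, Finset.mul_sum]
        refine Finset.sum_congr rfl fun i _ => ?_
        rw [← hz i]; field_simp
      rw [this, h1, mul_zero]
    intro i
    apply Subtype.ext
    rw [← hz i, h2]
    simp [(Fact.out : p.Prime).ne_zero]
  simpa using hli.fintype_card_le_finrank

theorem qpDeg_iso {K L : Type u} [Field K] [Field L] (e : K ≃+* L) (V : Set K) :
    qpDeg p (e '' V) = qpDeg p V := by
  have h1 : (qpP p K).map (e : K →+* L) = qpP p L := by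
    unfold qpP
    rw [RingHom.map_field_closure]
    congr 1
    ext y
    constructor
    · rintro ⟨_, ⟨z, rfl⟩, rfl⟩
      exact ⟨e z, by simp⟩
    · rintro ⟨z, rfl⟩
      exact ⟨_, ⟨e.symm z, rfl⟩, by simp⟩
  have h2 : (qpN p V).map (e : K →+* L) = qpN p (e '' V) := by
    unfold qpN
    rw [Subfield.map_sup, h1, RingHom.map_field_closure]
    congr 2
    ext y
    constructor
    · rintro ⟨_, ⟨a, ha, b, hb, rfl⟩, rfl⟩
      exact ⟨e a, ⟨a, ha, rfl⟩, e b, ⟨b, hb, rfl⟩, by simp⟩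
    · rintro ⟨_, ⟨a, ha, rfl⟩, _, ⟨b, hb, rfl⟩, rfl⟩
      exact ⟨_, ⟨a, ha, b, hb, rfl⟩, by simp⟩
  unfold qpDeg
  rw [← h1, ← h2, Subfield.relfinrank_map_map]

theorem mem_closure_range {R : Type u} [CommRing R] {L : Type u} [Field L] (ψ : R →+* L)
    (z : L) (hz : z ∈ Subfield.closure (Set.range ψ)) :
    ∃ a b, ψ b ≠ 0 ∧ z * ψ b = ψ a := by
  rw [Subfield.mem_closure_iff] at hz
  have h1 : Subring.closure (Set.range ψ) = ψ.range := by
    rw [← RingHom.coe_range, Subring.closure_eq]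
  rw [h1] at hz
  obtain ⟨_, ⟨a, rfl⟩, _, ⟨b, rfl⟩, rfl⟩ := hz
  by_cases hb : ψ b = 0
  · exact ⟨0, 1, by simp, by simp [hb]⟩
  · exact ⟨a, b, hb, by field_simp⟩

theorem mvpoly_pow_mem [Fact p.Prime] {K : Type u} [Field K] [CharP K p] {σ : Type}
    (A : Subfield K) (hA : qpP p K ≤ A) (g : MvPolynomial σ K) :
    ∃ g' : MvPolynomial σ A, MvPolynomial.map A.subtype g' = g ^ p := by
  induction g using MvPolynomial.induction_on with
  | C a =>
    exact ⟨MvPolynomial.C ⟨a ^ p, hA (pow_mem_qpP p a)⟩, by simp⟩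
  | add f g hf hg =>
    obtain ⟨f', hf⟩ := hf
    obtain ⟨g', hg⟩ := hg
    exact ⟨f' + g', by rw [map_add, hf, hg, add_pow_char]⟩
  | mul_X f i hf =>
    obtain ⟨f', hf⟩ := hf
    exact ⟨f' * MvPolynomial.X i ^ p, by rw [map_mul, hf, mul_pow]; simp⟩

theorem descend [Fact p.Prime] {K L : Type u} [Field K] [CharP K p] [Field L] [CharP L p]
    {σ : Type}
    (ψ : MvPolynomial σ K →+* L) (hψ : Function.Injective ψ)
    (A : Subfield K) (hA : qpP p K ≤ A) (z : K)
    (hz : ψ (MvPolynomial.C z) ∈ (Subfield.closure (Set.range ψ)).map (frobenius L p) ⊔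
      Subfield.closure ((fun a => ψ (MvPolynomial.C a)) '' A)) : z ∈ A := by
  set ψA : MvPolynomial σ A →+* L := ψ.comp (MvPolynomial.map A.subtype) with hψA
  have hle : (Subfield.closure (Set.range ψ)).map (frobenius L p) ⊔
      Subfield.closure ((fun a => ψ (MvPolynomial.C a)) '' A) ≤
        Subfield.closure (Set.range ψA) := by
    refine sup_le ?_ (Subfield.closure_mono ?_)
    · rw [RingHom.map_field_closure]
      refine Subfield.closure_mono ?_
      rintro _ ⟨_, ⟨g, rfl⟩, rfl⟩
      obtain ⟨g', hg'⟩ := mvpoly_pow_mem p A hA g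
      exact ⟨g', by simp [hψA, hg', frobenius_def]⟩
    · rintro _ ⟨a, ha, rfl⟩
      exact ⟨MvPolynomial.C ⟨a, ha⟩, by simp [hψA]⟩
  obtain ⟨r, q, hq, hrq⟩ := mem_closure_range ψA _ (hle hz)
  have h1 : MvPolynomial.C z * MvPolynomial.map A.subtype q = MvPolynomial.map A.subtype r := by
    apply hψ
    rw [map_mul]; exact hrq
  have hq0 : q ≠ 0 := by
    rintro rfl; simp at hq
  obtain ⟨α, hα⟩ := MvPolynomial.ne_zero_iff.1 hq0
  have h2 := congrArg (MvPolynomial.coeff α) h1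
  rw [MvPolynomial.coeff_C_mul, MvPolynomial.coeff_map, MvPolynomial.coeff_map] at h2
  have h3 : z = ((MvPolynomial.coeff α r : A) : K) / ((MvPolynomial.coeff α q : A) : K) := by
    rw [eq_div_iff]
    · exact h2
    · simpa using hα
  rw [h3]
  exact div_mem (Subtype.property _) (Subtype.property _)

theorem deg_transfer [Fact p.Prime] {K L : Type u} [Field K] [CharP K p] [Field L] [CharP L p]
    {σ : Type}
    (ψ : MvPolynomial σ K →+* L) (hψ : Function.Injective ψ) (B : Set K) (hB : B.Finite) :
    Subfield.relfinrank (qpP p K) (qpP p K ⊔ Subfield.closure B) =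
    Subfield.relfinrank ((Subfield.closure (Set.range ψ)).map (frobenius L p))
      ((Subfield.closure (Set.range ψ)).map (frobenius L p) ⊔
      Subfield.closure ((fun a => ψ (MvPolynomial.C a)) '' B)) := by
  set Ep := (Subfield.closure (Set.range ψ)).map (frobenius L p) with hEp
  induction B, hB using Set.Finite.induction_on with
  | empty => simp
  | @insert x s _ _ ih =>
    rw [Set.image_insert_eq, sup_closure_insert, sup_closure_insert,
      ← Subfield.relfinrank_mul_relfinrank
          (le_sup_left : qpP p K ≤ qpP p K ⊔ Subfield.closure s) le_sup_left,
      ← Subfield.relfinrank_mul_relfinrank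
          (le_sup_left : Ep ≤ Ep ⊔ Subfield.closure ((fun a => ψ (MvPolynomial.C a)) '' s))
          le_sup_left, ih]
    congr 1
    have hiff : x ∈ qpP p K ⊔ Subfield.closure s ↔ ψ (MvPolynomial.C x) ∈
        Ep ⊔ Subfield.closure ((fun a => ψ (MvPolynomial.C a)) '' s) := by
      constructor
      · intro hx
        have : qpP p K ⊔ Subfield.closure s ≤ Subfield.comap (ψ.comp MvPolynomial.C)
            (Ep ⊔ Subfield.closure ((fun a => ψ (MvPolynomial.C a)) '' s)) := by
          refine sup_le (Subfield.closure_le.2 ?_) (Subfield.closure_le.2 ?_)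
          · rintro _ ⟨z, rfl⟩
            refine (le_sup_left : Ep ≤ _) ⟨ψ (MvPolynomial.C z),
              Subfield.subset_closure ⟨_, rfl⟩, ?_⟩
            simp [frobenius_def]
          · intro z hz
            exact (le_sup_right : Subfield.closure _ ≤ _) (Subfield.subset_closure ⟨z, hz, rfl⟩)
        exact this hx
      · intro hx
        refine descend p ψ hψ _ le_sup_left x ?_
        refine (sup_le_sup_left (Subfield.closure_mono (Set.image_mono ?_)) _) hx
        exact Subfield.subset_closure.trans
          (SetLike.coe_subset_coe.2 (le_sup_right : Subfield.closure s ≤ _))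
    by_cases hx : x ∈ qpP p K ⊔ Subfield.closure s
    · rw [Subfield.relfinrank_eq_one_of_le, Subfield.relfinrank_eq_one_of_le]
      · simpa using hiff.1 hx
      · simpa using hx
    · rw [adj_relfinrank p _ x ((le_sup_left : qpP p K ≤ _) (pow_mem_qpP p x)) hx,
        adj_relfinrank p _ _ _ (fun h => hx (hiff.2 h))]
      refine (le_sup_left : Ep ≤ _) ⟨ψ (MvPolynomial.C x), Subfield.subset_closure ⟨_, rfl⟩, rfl⟩

theorem step_abs [Fact p.Prime] {K L : Type u} [Field K] [CharP K p] [Field L] [CharP L p]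
    {σ : Type}
    (ψ : MvPolynomial σ K →+* L) (hψ : Function.Injective ψ) (B : Set K) (hB : B.Finite)
    (θ : L) (hθ : θ ∉ Subfield.closure (Set.range ψ))
    (htop : ∀ z, z ∈ Subfield.closure (insert θ (Set.range ψ)))
    (hE : θ ^ p ∈ Subfield.closure (Set.range ψ))
    (hrel : θ ^ p ∈ (Subfield.closure (Set.range ψ)).map (frobenius L p) ⊔
      Subfield.closure ((fun a => ψ (MvPolynomial.C a)) '' B)) :
    Subfield.relfinrank (qpP p K) (qpP p K ⊔ Subfield.closure B) =
    p * Subfield.relfinrank (qpP p L) (qpP p L ⊔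
      Subfield.closure ((fun a => ψ (MvPolynomial.C a)) '' B)) := by
  rw [deg_transfer p ψ hψ B hB]
  set Ep := (Subfield.closure (Set.range ψ)).map (frobenius L p) with hEp
  have hLp : qpP p L = Ep ⊔ Subfield.closure {θ ^ p} := by
    apply le_antisymm
    · refine Subfield.closure_le.2 ?_
      rintro _ ⟨z, rfl⟩
      have h1 : z ^ p ∈ (Subfield.closure (insert θ (Set.range ψ))).map (frobenius L p) :=
        ⟨z, htop z, rfl⟩
      have h2 : (Subfield.closure (insert θ (Set.range ψ))).map (frobenius L p) ≤
          Ep ⊔ Subfield.closure {θ ^ p} := by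
        rw [hEp, RingHom.map_field_closure, RingHom.map_field_closure, ← Subfield.closure_union,
          Set.image_insert_eq, Set.union_singleton]
        rfl
      exact h2 h1
    · refine sup_le ?_ (Subfield.closure_le.2 ?_)
      · rintro _ ⟨z, _, rfl⟩
        exact pow_mem_qpP p z
      · rintro _ rfl
        exact pow_mem_qpP p θ
  have hN : qpP p L ⊔ Subfield.closure ((fun a => ψ (MvPolynomial.C a)) '' B) =
      Ep ⊔ Subfield.closure ((fun a => ψ (MvPolynomial.C a)) '' B) := by
    apply le_antisymm
    · refine sup_le ?_ le_sup_right
      rw [hLp]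
      refine sup_le le_sup_left (Subfield.closure_le.2 ?_)
      rintro _ rfl
      exact hrel
    · refine sup_le_sup_right ?_ _
      rw [hLp]; exact le_sup_left
  have hdeg : Subfield.relfinrank Ep (qpP p L) = p := by
    rw [hLp]
    refine adj_relfinrank p Ep _ ⟨θ ^ p, hE, rfl⟩ ?_
    rintro ⟨y, hy, hy'⟩
    have : y = θ := frobenius_inj L p hy'
    exact hθ (this ▸ hy)
  rw [hN, ← Subfield.relfinrank_mul_relfinrank (B := qpP p L), hdeg]
  · rw [hLp]; exact le_sup_left
  · rw [← hN]; exact le_sup_left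

theorem fse_rename {K : Type u} [Field K] (d : ℕ) (q : MvPolynomial (Fin d) K) :
    MvPolynomial.finSuccEquiv K d (MvPolynomial.rename Fin.succ q) = Polynomial.C q := by
  induction q using MvPolynomial.induction_on with
  | C a => simp [MvPolynomial.finSuccEquiv_apply]
  | add f g hf hg => rw [map_add, map_add, hf, hg, map_add]
  | mul_X f i hf =>
    rw [map_mul, map_mul, hf, MvPolynomial.rename_X, MvPolynomial.finSuccEquiv_X_succ, map_mul]

theorem fse_ffPoly {K : Type u} [Field K] (d : ℕ) (b : Fin (d + 1 + 1) → K) :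
    ∃ h, MvPolynomial.finSuccEquiv K d (ffPoly p K (d + 1) b) =
      Polynomial.C (MvPolynomial.C (b 0)) * Polynomial.X ^ p + Polynomial.C h := by
  refine ⟨MvPolynomial.C (b (Fin.last (d + 1))) +
    ∑ i : Fin d, MvPolynomial.C (b i.succ.castSucc) * MvPolynomial.X i ^ p, ?_⟩
  have hC : ∀ a : K, MvPolynomial.finSuccEquiv K d (MvPolynomial.C a) =
    Polynomial.C (MvPolynomial.C a) := fun a => by simp [MvPolynomial.finSuccEquiv_apply]
  unfold ffPoly
  rw [Fin.sum_univ_succ]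
  simp only [map_add, map_sum, map_mul, map_pow, hC, MvPolynomial.finSuccEquiv_X_zero,
    MvPolynomial.finSuccEquiv_X_succ, Fin.castSucc_zero]
  ring

theorem ffPoly_dvd [Fact p.Prime] {K : Type u} [Field K] (d : ℕ) (b : Fin (d + 1 + 1) → K)
    (hb : b 0 ≠ 0) (q r : MvPolynomial (Fin d) K)
    (h : ffPoly p K (d + 1) b ∣ MvPolynomial.rename Fin.succ q * MvPolynomial.X 0 -
      MvPolynomial.rename Fin.succ r) : q = 0 ∧ r = 0 := by
  have hp := (Fact.out : p.Prime)
  obtain ⟨h0, hh0⟩ := fse_ffPoly p d b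
  have h1 := map_dvd (MvPolynomial.finSuccEquiv K d) h
  rw [hh0, map_sub, map_mul, fse_rename, fse_rename, MvPolynomial.finSuccEquiv_X_zero] at h1
  have h2 : Polynomial.C q * Polynomial.X - Polynomial.C r = 0 := by
    by_contra hne
    have h3 := Polynomial.natDegree_le_of_dvd h1 hne
    have h4 : (Polynomial.C (MvPolynomial.C (b 0)) * Polynomial.X ^ p +
        Polynomial.C h0 : Polynomial (MvPolynomial (Fin d) K)).natDegree = p := by
      rw [Polynomial.natDegree_add_C, Polynomial.natDegree_C_mul_X_pow]
      simpa using hb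
    have h5 : (Polynomial.C q * Polynomial.X - Polynomial.C r).natDegree ≤ 1 := by
      rw [Polynomial.natDegree_sub_C]
      exact (Polynomial.natDegree_C_mul_le _ _).trans Polynomial.natDegree_X_le
    have := hp.two_le
    omega
  constructor
  · have := congrArg (fun P => Polynomial.coeff P 1) h2
    simpa [Polynomial.coeff_C] using this
  · have := congrArg (fun P => Polynomial.coeff P 0) h2
    simpa [Polynomial.coeff_C] using this

theorem step_conc [Fact p.Prime] {K L : Type u} [Field K] [CharP K p] [Field L] [CharP L p]
    (D : ℕ) (hD : 0 < D) (b : Fin (D + 1) → K) (hb : ∀ i, b i ≠ 0)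
    (e : L ≃+* ffRing p K D b) :
    qpDeg p (Set.range b) = p * qpDeg p (Set.range fun i => e.symm (ffMap p K D b (b i))) := by
  have hp := (Fact.out : p.Prime)
  obtain ⟨d, rfl⟩ : ∃ d, D = d + 1 := ⟨D - 1, by omega⟩
  set R := MvPolynomial (Fin (d + 1)) K ⧸ Ideal.span {ffPoly p K (d + 1) b} with hR
  set W : MvPolynomial (Fin (d + 1)) K →+* L := (e.symm : ffRing p K (d + 1) b →+* L).comp
    ((algebraMap R (FractionRing R)).comp (Ideal.Quotient.mk _)) with hW
  have hWC : ∀ a, W (MvPolynomial.C a) = e.symm (ffMap p K (d + 1) b a) := fun a => rfl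
  have hker : ∀ g, W g = 0 → ffPoly p K (d + 1) b ∣ g := by
    intro g hg
    have h1 : algebraMap R (FractionRing R) (Ideal.Quotient.mk _ g) = 0 :=
      e.symm.injective (hg.trans (map_zero e.symm).symm)
    have h2 : (Ideal.Quotient.mk (Ideal.span {ffPoly p K (d + 1) b}) g) = 0 :=
      IsFractionRing.injective R (FractionRing R) (h1.trans (map_zero _).symm)
    rwa [Ideal.Quotient.eq_zero_iff_mem, Ideal.mem_span_singleton] at h2
  have hWf : W (ffPoly p K (d + 1) b) = 0 := by
    have h2 : (Ideal.Quotient.mk (Ideal.span {ffPoly p K (d + 1) b}) (ffPoly p K (d + 1) b)) = 0 := by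
      rw [Ideal.Quotient.eq_zero_iff_mem, Ideal.mem_span_singleton]
    simp only [hW, RingHom.comp_apply]
    rw [h2]; simp
  set ψ : MvPolynomial (Fin d) K →+* L := W.comp (MvPolynomial.rename Fin.succ :
    MvPolynomial (Fin d) K →ₐ[K] MvPolynomial (Fin (d + 1)) K).toRingHom with hψd
  have hψa : ∀ g, ψ g = W (MvPolynomial.rename Fin.succ g) := fun g => rfl
  have hψC : ∀ a, ψ (MvPolynomial.C a) = e.symm (ffMap p K (d + 1) b a) := fun a => by
    rw [hψa, MvPolynomial.rename_C, hWC]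
  have hψX : ∀ i, ψ (MvPolynomial.X i) = W (MvPolynomial.X i.succ) := fun i => by
    rw [hψa, MvPolynomial.rename_X]
  have hψ : Function.Injective ψ := by
    rw [injective_iff_map_eq_zero]
    intro r hr
    refine (ffPoly_dvd p d b (hb 0) 0 r ?_).2
    apply hker
    rw [map_sub, map_zero, zero_mul, map_zero, ← hψa, hr, sub_zero]
  set θ := W (MvPolynomial.X 0) with hθd
  have hθ : θ ∉ Subfield.closure (Set.range ψ) := by
    intro h
    obtain ⟨r, q, hq, hqr⟩ := mem_closure_range ψ θ h
    have : q = 0 := by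
      refine (ffPoly_dvd p d b (hb 0) q r ?_).1
      apply hker
      rw [map_sub, map_mul, ← hψa, ← hψa, ← hθd, ← hqr, mul_comm, sub_self]
    rw [this, map_zero] at hq
    exact hq rfl
  have hWmem : ∀ g, W g ∈ Subfield.closure (insert θ (Set.range ψ)) := by
    intro g
    induction g using MvPolynomial.induction_on with
    | C a =>
      rw [hWC, ← hψC]
      exact Subfield.subset_closure (Or.inr ⟨_, rfl⟩)
    | add f g hf hg => rw [map_add]; exact add_mem hf hg
    | mul_X f i hf =>
      rw [map_mul]
      refine mul_mem hf ?_
      refine Fin.cases ?_ (fun i => ?_) i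
      · exact Subfield.subset_closure (Or.inl rfl)
      · rw [← hψX]
        exact Subfield.subset_closure (Or.inr ⟨_, rfl⟩)
  have htop : ∀ z, z ∈ Subfield.closure (insert θ (Set.range ψ)) := by
    intro z
    obtain ⟨⟨a, s⟩, has⟩ := IsLocalization.surj (nonZeroDivisors R) (e z)
    obtain ⟨a, rfl⟩ := Ideal.Quotient.mk_surjective a
    obtain ⟨s', hs'⟩ := Ideal.Quotient.mk_surjective (s : R)
    have h1 : z * W s' = W a := by
      apply e.injective
      rw [map_mul]
      simp only [hW, RingHom.comp_apply, RingEquiv.coe_toRingHom, RingEquiv.apply_symm_apply]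
      rw [hs']; exact has
    have h2 : W s' ≠ 0 := by
      have hu : IsUnit (e.symm (algebraMap R (FractionRing R) s)) :=
        (IsLocalization.map_units (FractionRing R) s).map e.symm
      have : W s' = e.symm (algebraMap R (FractionRing R) s) := by
        rw [← hs']; rfl
      rw [this]; exact hu.ne_zero
    rw [eq_div_of_mul_eq h2 h1]
    exact div_mem (hWmem _) (hWmem _)
  -- the relation
  have hrel0 : ψ (MvPolynomial.C (b 0)) * θ ^ p = -(ψ (MvPolynomial.C (b (Fin.last (d + 1)))) +
      ∑ i : Fin d, ψ (MvPolynomial.C (b i.succ.castSucc)) * ψ (MvPolynomial.X i) ^ p) := by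
    have := hWf
    unfold ffPoly at this
    rw [Fin.sum_univ_succ, map_add, map_add, map_sum] at this
    simp only [map_mul, map_pow, hWC, ← hψC, ← hψX, Fin.castSucc_zero] at this
    rw [← hθd] at this
    linear_combination this
  have hφ : ∀ i, ψ (MvPolynomial.C (b i)) ≠ 0 := fun i h => by
    have := hψ (h.trans (map_zero ψ).symm)
    simp [hb i] at this
  have hθp : θ ^ p = -(ψ (MvPolynomial.C (b (Fin.last (d + 1)))) +
      ∑ i : Fin d, ψ (MvPolynomial.C (b i.succ.castSucc)) * ψ (MvPolynomial.X i) ^ p) /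
        ψ (MvPolynomial.C (b 0)) := by
    rw [← hrel0, mul_div_cancel_left₀ _ (hφ 0)]
  have hbase : ∀ {M : Type u} [Field M] (c : Fin (d + 1 + 1) → M) (_ : c 0 ≠ 0),
      qpN p (Set.range c) = qpP p M ⊔ Subfield.closure (Set.range fun i => c i / c 0) := by
    intro M _ c hc
    rw [qpN_eq_base p (Set.range c) (c 0) (Set.mem_range_self 0) hc, ← Set.range_comp]
    rfl
  have hE : θ ^ p ∈ Subfield.closure (Set.range ψ) := by
    have hm : ∀ g, ψ g ∈ Subfield.closure (Set.range ψ) := fun g =>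
      Subfield.subset_closure ⟨g, rfl⟩
    rw [hθp]
    exact div_mem (neg_mem (add_mem (hm _) (sum_mem fun i _ => mul_mem (hm _)
      (pow_mem (hm _) _)))) (hm _)
  have key := step_abs p ψ hψ (Set.range fun i => b i / b 0) (Set.finite_range _) θ hθ htop hE (by
    have hm : ∀ i, ψ (MvPolynomial.C (b i)) / ψ (MvPolynomial.C (b 0)) ∈
        (Subfield.closure (Set.range ψ)).map (frobenius L p) ⊔
        Subfield.closure ((fun a => ψ (MvPolynomial.C a)) '' Set.range fun i => b i / b 0) := by
      intro i
      refine (le_sup_right : Subfield.closure _ ≤ _) (Subfield.subset_closure ⟨_, ⟨i, rfl⟩, ?_⟩)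
      exact map_div₀ (ψ.comp MvPolynomial.C) (b i) (b 0)
    rw [hθp, neg_div, add_div, Finset.sum_div]
    refine neg_mem (add_mem (hm _) (sum_mem fun i _ => ?_))
    rw [mul_div_right_comm]
    refine mul_mem (hm _) ((le_sup_left : (Subfield.closure (Set.range ψ)).map _ ≤ _) ?_)
    exact ⟨ψ (MvPolynomial.X i), Subfield.subset_closure ⟨_, rfl⟩, rfl⟩)
  unfold qpDeg
  rw [hbase b (hb 0), hbase _ (by rw [← hψC]; exact hφ 0), key]
  congr 4
  rw [← Set.range_comp]
  congr 1
  funext i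
  rw [← hψC, ← hψC]
  exact map_div₀ (ψ.comp MvPolynomial.C) (b i) (b 0)

theorem qpDeg_diag [Fact p.Prime] {K : Type u} [Field K] {m : ℕ} (b : Fin m → K)
    (j : Fin m) (hj : b j ≠ 0) : qpDeg p (Set.range (diagVal p b)) = qpDeg p (Set.range b) := by
  unfold qpDeg
  rw [qpN_diag p b j hj]

theorem tower [Fact p.Prime] (h : ℕ) (S : ℕ → QLStage.{u} p) (hchar : CharP (S 0).carrier p)
    (hdims : ∀ r, r < h → 1 < (S r).dim)
    (htop : (S h).dim = 1)
    (hanisoS : ∀ r, r ≤ h → ∀ x, diagVal p (S r).coeff x = 0 → x = 0)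
    (hstep : ∀ r, ∀ hr : r < h,
      ∃ (hdr : (S r).dim - 1 + 1 = (S r).dim)
        (e : (S (r + 1)).carrier ≃+*
          ffRing p (S r).carrier ((S r).dim - 1) ((S r).coeff ∘ Fin.cast hdr)),
        Set.range (diagVal p (S (r + 1)).coeff) =
          Set.range (diagVal p (fun i : Fin (S r).dim =>
            e.symm (ffMap p (S r).carrier ((S r).dim - 1)
              ((S r).coeff ∘ Fin.cast hdr) ((S r).coeff i))))) :
    ∀ r, r ≤ h → CharP (S r).carrier p ∧
      qpDeg p (Set.range (S 0).coeff) = p ^ r * qpDeg p (Set.range (S r).coeff) := by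
  intro r
  induction r with
  | zero => intro _; exact ⟨hchar, by simp⟩
  | succ r ih =>
    intro hr
    obtain ⟨hc, ih⟩ := ih (by omega)
    obtain ⟨hdr, e, hV⟩ := hstep r (by omega)
    have hpos : 0 < (S (r + 1)).dim := by
      rcases Nat.lt_or_eq_of_le hr with h1 | h1
      · have := hdims _ h1; omega
      · rw [h1, htop]; exact one_pos
    have hd1 := hdims r (by omega)
    set φ : (S r).carrier →+* (S (r + 1)).carrier := (e.symm : _ →+* (S (r + 1)).carrier).comp
      (ffMap p (S r).carrier ((S r).dim - 1) ((S r).coeff ∘ Fin.cast hdr)) with hφ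
    have hc' : CharP (S (r + 1)).carrier p := charP_of_injective_ringHom φ.injective p
    refine ⟨hc', ?_⟩
    have hnz := aniso_ne_zero p _ (hanisoS r (by omega))
    have hst := step_conc p ((S r).dim - 1) (by omega) ((S r).coeff ∘ Fin.cast hdr)
      (fun i => hnz _) e
    have h1 : Set.range ((S r).coeff ∘ Fin.cast hdr) = Set.range (S r).coeff :=
      (finCongr hdr).surjective.range_comp _
    have h2 : (Set.range fun i => e.symm (ffMap p (S r).carrier ((S r).dim - 1)
        ((S r).coeff ∘ Fin.cast hdr) (((S r).coeff ∘ Fin.cast hdr) i))) =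
        Set.range (fun i : Fin (S r).dim =>
            e.symm (ffMap p (S r).carrier ((S r).dim - 1)
              ((S r).coeff ∘ Fin.cast hdr) ((S r).coeff i))) :=
      (finCongr hdr).surjective.range_comp (fun i : Fin (S r).dim =>
            e.symm (ffMap p (S r).carrier ((S r).dim - 1)
              ((S r).coeff ∘ Fin.cast hdr) ((S r).coeff i)))
    rw [h1, h2] at hst
    rw [← qpDeg_diag p (S (r + 1)).coeff ⟨0, hpos⟩
      (aniso_ne_zero p _ (hanisoS (r + 1) hr) _), hV,
      qpDeg_diag p _ ⟨0, by omega⟩ (fun h0 => hnz ⟨0, by omega⟩ (φ.injective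
        (h0.trans (map_zero φ).symm))), ih, hst, pow_succ, mul_assoc]

end helpers

/-- Let `φ` be an anisotropic quasilinear `p`-form of dimension
`d + 1 > 1` over a field `F` of characteristic `p`, and `n ≥ 0` with
`p^n < dim φ ≤ p^{n+1}`.  Let `S` be the standard splitting tower of `φ` of height
`h`: `S 0` is `(F, φ)` (up to isomorphism); for `r < h` the field of `S (r+1)` is the
function field of the hypersurface of the form `φ_r` of `S r`, and the form of
`S (r+1)` is anisotropic with the same value set as `(φ_r)` extended (i.e. it is the
anisotropic part `((φ_r)_{F_{r+1}})_an`); `dim φ_r > 1` for `r < h` and `dim φ_h = 1`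
(completely split).  Then `φ` is a quasi-Pfister neighbour (some nonzero scalar
multiple of `φ` is a subform of a quasi-Pfister form `π` with `p·dim φ > dim π`)
if and only if `h = n + 1`; and in any case `h ≥ n + 1`. -/
theorem stmt18 {p : ℕ} [Fact p.Prime] (F : Type u) [Field F] [CharP F p]
    (d : ℕ) (hd : 0 < d) (c : Fin (d + 1) → F)
    (haniso : ∀ x, diagVal p c x = 0 → x = 0)
    (n : ℕ) (hn1 : p ^ n < d + 1) (hn2 : d + 1 ≤ p ^ (n + 1))
    (h : ℕ) (S : ℕ → QLStage.{u} p)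
    (h0 : ∃ (e : (S 0).carrier ≃+* F) (h0d : (S 0).dim = d + 1),
      ∀ i, e ((S 0).coeff i) = c (Fin.cast h0d i))
    (hdims : ∀ r, r < h → 1 < (S r).dim)
    (htop : (S h).dim = 1)
    (hanisoS : ∀ r, r ≤ h → ∀ x, diagVal p (S r).coeff x = 0 → x = 0)
    (hstep : ∀ r, ∀ hr : r < h,
      ∃ (hdr : (S r).dim - 1 + 1 = (S r).dim)
        (e : (S (r + 1)).carrier ≃+*
          ffRing p (S r).carrier ((S r).dim - 1) ((S r).coeff ∘ Fin.cast hdr)),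
        Set.range (diagVal p (S (r + 1)).coeff) =
          Set.range (diagVal p (fun i : Fin (S r).dim =>
            e.symm (ffMap p (S r).carrier ((S r).dim - 1)
              ((S r).coeff ∘ Fin.cast hdr) ((S r).coeff i))))) :
    ((∃ (mm : ℕ) (a : Fin mm → F) (s : F), s ≠ 0 ∧ p * (d + 1) > p ^ mm ∧
        ∃ f : (Fin (d + 1) → F) →ₗ[F] ((Fin mm → Fin p) → F),
          Function.Injective f ∧
          ∀ v, diagVal p (pfCoeff a) (f v) = s * diagVal p c v) ↔ h = n + 1) ∧
      n + 1 ≤ h := by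
  have hp := (Fact.out : p.Prime)
  obtain ⟨e, h0d, he⟩ := h0
  have hchar : CharP (S 0).carrier p :=
    charP_of_injective_ringHom (f := (e.symm : F →+* (S 0).carrier)) e.symm.injective p
  obtain ⟨hch, hT⟩ := tower p h S hchar hdims htop hanisoS hstep h le_rfl
  have hdegc : qpDeg p (Set.range c) = p ^ h := by
    have h1 : Set.range c = e '' Set.range (S 0).coeff := by
      rw [← Set.range_comp]
      have h2 : (e ∘ (S 0).coeff) = c ∘ Fin.cast h0d := funext he
      rw [h2]
      exact ((finCongr h0d).surjective.range_comp c).symm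
    rw [h1, qpDeg_iso, hT]
    have h3 : qpDeg p (Set.range (S h).coeff) = 1 := by
      unfold qpDeg
      apply Subfield.relfinrank_eq_one_of_le
      refine sup_le le_rfl (Subfield.closure_le.2 ?_)
      rintro _ ⟨_, ⟨i, rfl⟩, _, ⟨j, rfl⟩, rfl⟩
      have hij : i = j := Fin.ext (by have := i.2; have := j.2; omega)
      rw [hij, div_self (aniso_ne_zero p _ (hanisoS h le_rfl) j)]
      exact one_mem (qpP p (S h).carrier)
    rw [h3, mul_one]
  have hc0 := aniso_ne_zero p c haniso
  have hdim : d + 1 ≤ p ^ h := by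
    rw [← hdegc]
    apply aniso_dim_le p c 0 haniso
    rw [hdegc]
    exact pow_ne_zero _ hp.ne_zero
  have hge : n + 1 ≤ h := (Nat.pow_lt_pow_iff_right hp.one_lt).1 (hn1.trans_le hdim)
  refine ⟨⟨?_, ?_⟩, hge⟩
  · rintro ⟨mm, a, s, hs, hmm, f, hf, hfv⟩
    have hpf : ∀ v : (Fin mm → Fin p) → F, diagVal p (pfCoeff a) v ∈ qpP p F ⊔ Subfield.closure (Set.range a) := by
      intro v
      refine sum_mem fun ε _ => mul_mem (prod_mem fun i _ => pow_mem ?_ _)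
        ((le_sup_left : qpP p F ≤ _) (pow_mem_qpP p _))
      exact (le_sup_right : Subfield.closure _ ≤ _) (Subfield.subset_closure ⟨i, rfl⟩)
    have hsc : ∀ i, s * c i ∈ qpP p F ⊔ Subfield.closure (Set.range a) := by
      intro i
      obtain ⟨x, hx⟩ := mem_range_diagVal p c i
      rw [← hx, ← hfv]
      exact hpf _
    have hN : qpN p (Set.range c) ≤ qpP p F ⊔ Subfield.closure (Set.range a) := by
      refine sup_le le_sup_left (Subfield.closure_le.2 ?_)
      rintro _ ⟨_, ⟨i, rfl⟩, _, ⟨j, rfl⟩, rfl⟩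
      have := div_mem (hsc i) (hsc j)
      rwa [mul_div_mul_left _ _ hs] at this
    have hdvd : p ^ h ∣ p ^ mm := by
      refine dvd_trans ?_ (adj_relfinrank_le p (qpP p F) le_rfl mm a)
      rw [← hdegc, ← Subfield.relfinrank_mul_relfinrank
        (le_sup_left : qpP p F ≤ qpN p (Set.range c)) hN]
      exact dvd_mul_right _ _
    have h1 : p ^ h < p ^ (n + 2) := by
      calc p ^ h ≤ p ^ mm := Nat.le_of_dvd (pow_pos hp.pos _) hdvd
        _ < p * (d + 1) := hmm
        _ ≤ p * p ^ (n + 1) := Nat.mul_le_mul_left _ hn2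
        _ = p ^ (n + 2) := by ring
    have := (Nat.pow_lt_pow_iff_right hp.one_lt).1 h1
    omega
  · intro hh
    have hbase := qpN_eq_base p (Set.range c) (c 0) (Set.mem_range_self 0) (hc0 0)
    obtain ⟨m, a, ha1, ha2⟩ := exists_pbasis p ((fun a => a / c 0) '' Set.range c)
      ((Set.finite_range c).image _)
    rw [← hbase] at ha1 ha2
    have hm : m = n + 1 := by
      have : p ^ m = p ^ h := by rw [← hdegc, ← ha2]; rfl
      rw [← hh]
      exact Nat.pow_right_injective hp.two_le this
    subst hm
    have hmem : ∀ i, c i / c 0 ∈ qpP p F ⊔ Subfield.closure (Set.range a) := by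
      intro i
      rw [← ha1, hbase]
      exact (le_sup_right : Subfield.closure _ ≤ _)
        (Subfield.subset_closure ⟨_, ⟨i, rfl⟩, rfl⟩)
    choose w hw using fun i => pf_surj p (n + 1) a (c i / c 0) (hmem i)
    have hval : ∀ v : Fin (d + 1) → F,
        diagVal p (pfCoeff a) (∑ i, v i • w i) = (c 0)⁻¹ * diagVal p c v := by
      intro v
      have : ∀ ε : Fin (n + 1) → Fin p,
          (∑ i, v i • w i) ε ^ p = ∑ i, v i ^ p * w i ε ^ p := by
        intro ε
        rw [Finset.sum_apply, sum_pow_char]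
        simp [mul_pow]
      unfold diagVal
      simp only [this, Finset.mul_sum]
      rw [Finset.sum_comm]
      refine Finset.sum_congr rfl fun i _ => ?_
      have h2 : (c 0)⁻¹ * (c i * v i ^ p) = (c i / c 0) * v i ^ p := by
        rw [div_eq_mul_inv]; ring
      rw [h2, ← hw i, diagVal, Finset.sum_mul]
      refine Finset.sum_congr rfl fun ε _ => ?_
      ring
    refine ⟨n + 1, a, (c 0)⁻¹, inv_ne_zero (hc0 0), ?_, Fintype.linearCombination F w, ?_, ?_⟩
    · rw [pow_succ, mul_comm (p ^ n)]
      exact Nat.mul_lt_mul_of_pos_left hn1 hp.pos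
    · rw [injective_iff_map_eq_zero]
      intro v hv
      apply haniso
      have h3 := hval v
      rw [Fintype.linearCombination_apply] at hv
      rw [hv] at h3
      have h4 : diagVal p (pfCoeff a) (0 : (Fin (n + 1) → Fin p) → F) = 0 := by
        simp [diagVal, hp.ne_zero]
      rw [h4] at h3
      exact (mul_eq_zero.1 h3.symm).resolve_left (inv_ne_zero (hc0 0))
    · intro v
      rw [Fintype.linearCombination_apply]
      exact hval v
end
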